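/- arXiv:2308.15187 — 3 statements merged into one kernel-verified Lean document; each statement's English description precedes it below -/
import Mathlib

section
/- Up to unimodular equivalence there exist exactly 16 two-dimensional reflexive polytopes: the set of reflexive polygons in ℝ², modulo the equivalence relation Δ ∼ Δ′ iff Δ′ = A(Δ) for some A ∈ GL₂(ℤ) (acting ℝ-linearly on ℝ²), has precisely 16 elements. -/
open Finset

/-- The standard dot product on `Fin n → ℝ`. -/
def dotp {n : ℕ} (x y : Fin n → ℝ) : ℝ := ∑ i, x i * y i

/-- A point of `ℝⁿ` all of whose coordinates are integers. -/
def IsLatticePoint {n : ℕ} (x : Fin n → ℝ) : Prop := ∀ i, ∃ m : ℤ, x i = (m : ℝ)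

/-- A lattice polytope: the convex hull of finitely many lattice points. -/
def IsLatticePolytope {n : ℕ} (Δ : Set (Fin n → ℝ)) : Prop :=
  ∃ V : Set (Fin n → ℝ), V.Finite ∧ (∀ v ∈ V, IsLatticePoint v) ∧ Δ = convexHull ℝ V

/-- A (nonempty) face of a convex set `Δ`, cut out by a supporting hyperplane. -/
def IsFaceOf {n : ℕ} (F Δ : Set (Fin n → ℝ)) : Prop :=
  F.Nonempty ∧ ∃ u : Fin n → ℝ, ∃ c : ℝ,
    (∀ x ∈ Δ, dotp x u ≤ c) ∧ F = {x ∈ Δ | dotp x u = c}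

/-- The dimension of a subset of `ℝⁿ`: the dimension of its affine span. -/
noncomputable def faceDim {n : ℕ} (F : Set (Fin n → ℝ)) : ℕ :=
  Module.finrank ℝ ↥(vectorSpan ℝ F)

/-- A reflexive polytope with respect to the lattice `ℤⁿ`: a lattice polytope with `0` in its
interior, each of whose facets lies on a hyperplane `{x | ⟨x, l⟩ = -1}` with `l ∈ ℤⁿ`. -/
def IsReflexive {n : ℕ} (Δ : Set (Fin n → ℝ)) : Prop :=
  IsLatticePolytope Δ ∧ (0 : Fin n → ℝ) ∈ interior Δ ∧
    ∀ F : Set (Fin n → ℝ), IsFaceOf F Δ → faceDim F + 1 = n →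
      ∃ l : Fin n → ℤ, F ⊆ {x | dotp x (fun i => (l i : ℝ)) = -1}

/-- The dual (polar) set `Δ* = {y | ⟨x, y⟩ ≥ -1 for all x ∈ Δ}`. -/
def dualSet {n : ℕ} (Δ : Set (Fin n → ℝ)) : Set (Fin n → ℝ) :=
  {y | ∀ x ∈ Δ, -1 ≤ dotp x y}

/-- The face of `Δ*` dual to a face `Θ` of `Δ`. -/
def dualFace {n : ℕ} (Δ Θ : Set (Fin n → ℝ)) : Set (Fin n → ℝ) :=
  {y ∈ dualSet Δ | ∀ x ∈ Θ, dotp x y = -1}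

/-- Unimodular equivalence: `Δ' = A(Δ)` for some `A ∈ GLₙ(ℤ)` acting `ℝ`-linearly on `ℝⁿ`. -/
def UnimodEquiv {n : ℕ} (Δ Δ' : Set (Fin n → ℝ)) : Prop :=
  ∃ A : Matrix (Fin n) (Fin n) ℤ, IsUnit A.det ∧
    Δ' = (fun x => (A.map (fun z : ℤ => (z : ℝ))).mulVec x) '' Δ

namespace ReflexivePolygon

/-! ### Lattice points in the plane -/

/-- The determinant of two integer vectors of the plane. -/
def det (p q : ℤ × ℤ) : ℤ := p.1 * q.2 - p.2 * q.1

/-- The integer combination `s.1 • p + s.2 • q`. -/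
def combo (p q s : ℤ × ℤ) : ℤ × ℤ := (s.1 * p.1 + s.2 * q.1, s.1 * p.2 + s.2 * q.2)

/-- The boundary lattice points, in cyclic order, of representatives of the equivalence classes of
reflexive polygons. -/
def boundaries : List (List (ℤ × ℤ)) :=
  [[(1, 0), (0, 1), (-1, -1)],
   [(1, 0), (0, 1), (-1, -2), (0, -1)],
   [(1, 0), (0, 1), (-1, -1), (0, -1)],
   [(1, 0), (0, 1), (-1, 0), (0, -1)],
   [(1, 0), (0, 1), (-1, -1), (0, -1), (1, -1)],
   [(1, 0), (0, 1), (-1, 0), (0, -1), (1, -1)],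
   [(1, 0), (0, 1), (-1, -1), (0, -1), (1, -1), (2, -1)],
   [(1, 0), (0, 1), (-1, 0), (0, -1), (1, -1), (2, -1)],
   [(1, 0), (0, 1), (-1, 0), (-1, -1), (0, -1), (1, -1)],
   [(1, 0), (0, 1), (-1, 1), (-1, 0), (0, -1), (1, -1)],
   [(1, 0), (0, 1), (-1, 0), (-1, -1), (0, -1), (1, -1), (2, -1)],
   [(1, 0), (0, 1), (-1, 1), (-1, 0), (0, -1), (1, -1), (2, -1)],
   [(1, 0), (0, 1), (-1, 0), (-2, -1), (-1, -1), (0, -1), (1, -1), (2, -1)],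
   [(1, 0), (0, 1), (-1, 1), (-1, 0), (-1, -1), (0, -1), (1, -1), (2, -1)],
   [(1, 0), (0, 1), (-1, 1), (-2, 1), (-1, 0), (0, -1), (1, -1), (2, -1)],
   [(1, 0), (0, 1), (-1, 2), (-1, 1), (-1, 0), (-1, -1), (0, -1), (1, -1), (2, -1)]]

/-- Membership in a list of lattice points, in a form suited to evaluation in the kernel. -/
noncomputable def mem (l : List (ℤ × ℤ)) (p : ℤ × ℤ) : Bool :=
  l.any fun q => Int.beq' q.1 p.1 && Int.beq' q.2 p.2

@[simp] lemma mem_eq_true {l : List (ℤ × ℤ)} {p : ℤ × ℤ} : (mem l p = true) = (p ∈ l) := by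
  simp [mem]

/-- The edge vectors of the closed polygonal path with the given vertices. -/
def edges (c : List (ℤ × ℤ)) : List (ℤ × ℤ) :=
  List.zipWith (fun p q => (q.1 - p.1, q.2 - p.2)) c (c.tail ++ c.take 1)

/-! ### Checking the lattice points of an intersection of half-planes -/

/-- The half-planes `-1 ≤ det d s`, for `d ∈ ds`, confine `det s u` to be at most `4`. -/
noncomputable def boundedAlong (ds : List (ℤ × ℤ)) (u : ℤ × ℤ) : Bool :=
  ds.any fun d => ds.any fun e => Int.blt' 0 (det d e) && Int.ble' 0 (det u e) &&
    Int.ble' 0 (det d u) && Int.ble' (det u e + det d u) (4 * det d e)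

/-- The integers of absolute value at most `4`. -/
def smallInts : List ℤ := [-4, -3, -2, -1, 0, 1, 2, 3, 4]

/-- A sufficient test that every lattice point of the intersection of the half-planes
`-1 ≤ det d s`, for `d ∈ ds`, lies in `pts`. -/
noncomputable def confines (pts ds : List (ℤ × ℤ)) : Bool :=
  [(1, 0), (-1, 0), (0, 1), (0, -1)].all (boundedAlong ds) &&
    smallInts.all fun x => smallInts.all fun y =>
      ds.any (fun d => Int.blt' (det d (x, y)) (-1)) || mem pts (x, y)

lemma det_le_of_boundedAlong {ds : List (ℤ × ℤ)} {u s : ℤ × ℤ} (h : boundedAlong ds u = true)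
    (hs : ∀ d ∈ ds, -1 ≤ det d s) : det s u ≤ 4 := by
  simp only [boundedAlong, List.any_eq_true, Bool.and_eq_true, Int.ble'_eq_true,
    Int.blt'_eq_true] at h
  obtain ⟨d, hd, e, he, ⟨⟨hde, hue⟩, hdu⟩, hle⟩ := h
  have h₁ := hs d hd
  have h₂ := hs e he
  have key : det d e * det s u = -(det u e * det d s) - det d u * det e s := by
    simp only [det]; ring
  nlinarith

lemma mem_smallInts {x : ℤ} (h₁ : -4 ≤ x) (h₂ : x ≤ 4) : x ∈ smallInts := by
  interval_cases x <;> decide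

lemma mem_of_confines {pts ds : List (ℤ × ℤ)} (h : confines pts ds = true) {s : ℤ × ℤ}
    (hs : ∀ d ∈ ds, -1 ≤ det d s) : s ∈ pts := by
  simp only [confines, Bool.and_eq_true, List.all_cons, List.all_nil, Bool.and_true] at h
  obtain ⟨⟨h₁, h₂, h₃, h₄⟩, h⟩ := h
  have b₁ := det_le_of_boundedAlong h₁ hs
  have b₂ := det_le_of_boundedAlong h₂ hs
  have b₃ := det_le_of_boundedAlong h₃ hs
  have b₄ := det_le_of_boundedAlong h₄ hs
  simp only [det] at b₁ b₂ b₃ b₄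
  have h' := List.all_eq_true.1 h s.1 (mem_smallInts (by linarith) (by linarith))
  have h'' := List.all_eq_true.1 h' s.2 (mem_smallInts (by linarith) (by linarith))
  simp only [Bool.or_eq_true, List.any_eq_true, Int.blt'_eq_true, mem_eq_true] at h''
  rcases h'' with ⟨d, hd, hlt⟩ | hmem
  · linarith [hs d hd]
  · exact hmem

/-! ### Unimodular equivalence of finite sets of lattice points -/

/-- Some unimodular map carries the points of `c` onto those of `pts`. -/
noncomputable def equivalent (c pts : List (ℤ × ℤ)) : Bool :=
  pts.any fun p => pts.any fun q => (Int.beq' (det p q) 1 || Int.beq' (det p q) (-1)) &&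
    c.all (fun s => mem pts (combo p q s)) &&
    pts.all (mem (c.map (combo p q)))

lemma equivalent_iff {c pts : List (ℤ × ℤ)} : equivalent c pts = true ↔
    ∃ p ∈ pts, ∃ q ∈ pts, IsUnit (det p q) ∧ combo p q '' {s | s ∈ c} = {s | s ∈ pts} := by
  simp only [equivalent, List.any_eq_true, List.all_eq_true, Bool.and_eq_true, Bool.or_eq_true,
    Int.beq'_eq, mem_eq_true, List.mem_map, Int.isUnit_iff, and_assoc]
  refine exists_congr fun p => and_congr_right fun _ => exists_congr fun q =>
    and_congr_right fun _ => and_congr_right fun _ => ?_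
  constructor
  · rintro ⟨h₁, h₂⟩
    ext t
    constructor
    · rintro ⟨s, hs, rfl⟩
      exact h₁ s hs
    · intro ht
      obtain ⟨s, hs, rfl⟩ := h₂ t ht
      exact ⟨s, hs, rfl⟩
  · intro h
    refine ⟨fun s hs => ?_, fun t ht => ?_⟩
    · exact h.subset ⟨s, hs, rfl⟩
    · obtain ⟨s, hs, rfl⟩ := h.superset ht
      exact ⟨s, hs, rfl⟩

/-! ### Walking around the boundary -/

/-- The properties of the set `T` of lattice points of a reflexive polygon which allow one to walk
around its boundary: no edge has lattice length more than `4`, and any two adjacent boundary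
lattice points `p`, `q` are followed by a boundary lattice point `a • q - p` with `|a| ≤ 2`. -/
structure IsWalkable (T : Set (ℤ × ℤ)) : Prop where
  short : ∀ p ∈ T, ∀ d, det p d = 1 → (∀ s ∈ T, -1 ≤ det d s) →
    (p.1 + 5 * d.1, p.2 + 5 * d.2) ∉ T
  next : ∀ p ∈ T, ∀ q ∈ T, det p q = 1 → (∀ s ∈ T, -1 ≤ det (q.1 - p.1, q.2 - p.2) s) →
    ∃ a ∈ [-2, -1, 0, 1, 2], (a * q.1 - p.1, a * q.2 - p.2) ∈ T ∧
      ∀ s ∈ T, -1 ≤ det (a * q.1 - p.1 - q.1, a * q.2 - p.2 - q.2) s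

/-- Search through all walks of at most `n` steps that arrive at the boundary point `q` from `p`,
in a set known to contain `pts` and to lie in the half-planes `-1 ≤ det d s`, for `d ∈ ds`. The
result is `true` if each of them is contradictory or returns to `pts` and thereby determines the
set, which is then equivalent to one of the representatives. -/
noncomputable def search : ℕ → ℤ × ℤ → ℤ × ℤ → List (ℤ × ℤ) → List (ℤ × ℤ) → Bool
  | 0, _, _, _, _ => false
  | n + 1, p, q, pts, ds =>
    if mem pts q then
      confines pts ds && boundaries.any fun c =>
        Nat.beq (c.length + 1) pts.length && equivalent ((0, 0) :: c) pts
    else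
      [-2, -1, 0, 1, 2].all fun a =>
        let r := (a * q.1 - p.1, a * q.2 - p.2)
        let d := (r.1 - q.1, r.2 - q.2)
        (q :: pts).any (fun s => Int.blt' (det d s) (-1)) ||
          ds.any (fun e => Int.blt' (det e r) (-1)) ||
          mem pts (r.1 - 5 * d.1, r.2 - 5 * d.2) || search n q r (q :: pts) (d :: ds)

lemma exists_equivalent_of_search {T : Set (ℤ × ℤ)} (hT : IsWalkable T) (n : ℕ) {p q : ℤ × ℤ}
    {pts ds : List (ℤ × ℤ)} (h : search n p q pts ds = true) (hp : p ∈ T) (hq : q ∈ T)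
    (hpq : det p q = 1) (hhalf : ∀ s ∈ T, -1 ≤ det (q.1 - p.1, q.2 - p.2) s)
    (hpts : ∀ s ∈ pts, s ∈ T) (hds : ∀ d ∈ ds, ∀ s ∈ T, -1 ≤ det d s) :
    ∃ c ∈ boundaries, ∃ p q, IsUnit (det p q) ∧ combo p q '' {s | s ∈ (0, 0) :: c} = T := by
  induction n generalizing p q pts ds with
  | zero => simp [search] at h
  | succ n ih =>
    rw [search] at h
    split_ifs at h
    · obtain ⟨h₁, h₂⟩ := (Bool.and_eq_true _ _).mp h
      obtain ⟨c, hc, hequiv⟩ := List.any_eq_true.1 h₂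
      obtain ⟨p, -, q, -, hu, himg⟩ := equivalent_iff.1 ((Bool.and_eq_true _ _).mp hequiv).2
      refine ⟨c, hc, p, q, hu, himg.trans (Set.Subset.antisymm hpts fun s hs => ?_)⟩
      exact mem_of_confines h₁ fun d hd => hds d hd s hs
    · obtain ⟨a, ha, hr, hr'⟩ := hT.next p hp q hq hpq hhalf
      have ha' := List.all_eq_true.1 h a ha
      simp only [Bool.or_eq_true, List.any_eq_true, Int.blt'_eq_true, mem_eq_true, or_assoc] at ha'
      set r : ℤ × ℤ := (a * q.1 - p.1, a * q.2 - p.2) with hrdef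
      have hqr : det q r = 1 := by
        rw [← hpq]; simp only [det, hrdef]; ring
      have hpts' : ∀ s ∈ q :: pts, s ∈ T := by
        rintro s (_ | ⟨_, hs⟩)
        · exact hq
        · exact hpts s hs
      rcases ha' with ⟨s, hs, hlt⟩ | ⟨d, hd, hlt⟩ | hmem | hrec
      · linarith [hr' s (hpts' s hs)]
      · linarith [hds d hd r hr]
      · refine absurd hr ?_
        have := hT.short _ (hpts _ hmem) (r.1 - q.1, r.2 - q.2)
          (by simp only [det] at hqr ⊢; linarith) hr'
        convert this using 2
        ext <;> simp only [hrdef] <;> ring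
      · refine ih hrec hq hr hqr hr' hpts' ?_
        rintro d (_ | ⟨_, hd⟩)
        · exact hr'
        · exact hds d hd

lemma search_eq_true : search 10 (1, 0) (0, 1) [(1, 0), (0, 0)] [(-1, 1)] = true := by
  decide +kernel

/-! ### Properties of the representatives -/

/-- A finite test for the polygon spanned by the closed path `c` to be a reflexive polygon with
lattice points `0` and `c`. -/
noncomputable def isReflexivePath (c : List (ℤ × ℤ)) : Bool :=
  confines ((0, 0) :: c) (edges c) &&
  ((0, 0) :: c).all (fun p => (edges c).all fun d => Int.ble' (-1) (det d p)) &&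
  mem c (1, 0) && mem c (0, 1) &&
  c.any (fun p => c.any fun q => Int.blt' (p.1 + q.1) 0 && Int.blt' (p.2 + q.2) 0) &&
  ((0, 0) :: c).all fun p => ((0, 0) :: c).all fun q => mem [p] q ||
    (edges c).any (fun d => Int.beq' (det d p) (-1) && Int.beq' (det d q) (-1)) ||
    (c.any (fun s => Int.blt' 0 (det (q.1 - p.1, q.2 - p.2) (s.1 - p.1, s.2 - p.2))) &&
      c.any fun s => Int.blt' (det (q.1 - p.1, q.2 - p.2) (s.1 - p.1, s.2 - p.2)) 0)

lemma isReflexivePath_of_mem_boundaries : ∀ c ∈ boundaries, isReflexivePath c = true := by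
  decide +kernel

lemma eq_of_equivalent : ∀ c ∈ boundaries, ∀ c' ∈ boundaries,
    equivalent ((0, 0) :: c) ((0, 0) :: c') = true → c = c' := by
  decide +kernel

lemma card_boundaries : boundaries.toFinset.card = 16 := by
  decide +kernel

/-! ### Convex geometry of the plane -/

/-- The point of the real plane with the given integer coordinates. -/
def toReal (p : ℤ × ℤ) : Fin 2 → ℝ := ![(p.1 : ℝ), (p.2 : ℝ)]

@[simp] lemma toReal_apply_zero (p : ℤ × ℤ) : toReal p 0 = p.1 := rfl

@[simp] lemma toReal_apply_one (p : ℤ × ℤ) : toReal p 1 = p.2 := rfl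

@[simp] lemma toReal_zero : toReal 0 = 0 := by
  ext i
  fin_cases i <;> simp

/-- The determinant of two real vectors of the plane. -/
def cross (u x : Fin 2 → ℝ) : ℝ := u 0 * x 1 - u 1 * x 0

lemma cross_toReal (p q : ℤ × ℤ) : cross (toReal p) (toReal q) = det p q := by
  simp [cross, det]

lemma dotp_eq_cross (x u : Fin 2 → ℝ) : dotp x u = cross ![u 1, -u 0] x := by
  simp [dotp, cross, Fin.sum_univ_two]; ring

lemma toReal_injective : Function.Injective toReal := by
  intro p q h
  have h₀ := congrFun h 0
  have h₁ := congrFun h 1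
  simp only [toReal_apply_zero, toReal_apply_one, Int.cast_inj] at h₀ h₁
  exact Prod.ext h₀ h₁

/-- The lattice polygon spanned by a set of lattice points. -/
def hull (S : Set (ℤ × ℤ)) : Set (Fin 2 → ℝ) := convexHull ℝ (toReal '' S)

lemma toReal_mem_hull {S : Set (ℤ × ℤ)} {s : ℤ × ℤ} (hs : s ∈ S) : toReal s ∈ hull S :=
  subset_convexHull ℝ _ ⟨s, hs, rfl⟩

lemma convex_hull (S : Set (ℤ × ℤ)) : Convex ℝ (hull S) := convex_convexHull ℝ _

/-- The linear functional `cross u`. -/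
def crossLin (u : Fin 2 → ℝ) : (Fin 2 → ℝ) →ₗ[ℝ] ℝ :=
  u 0 • LinearMap.proj 1 - u 1 • LinearMap.proj 0

lemma crossLin_apply (u x : Fin 2 → ℝ) : crossLin u x = cross u x := by
  simp [crossLin, cross]

lemma le_cross_of_mem_hull {S : Set (ℤ × ℤ)} {u x : Fin 2 → ℝ} {c : ℝ}
    (h : ∀ s ∈ S, c ≤ cross u (toReal s)) (hx : x ∈ hull S) : c ≤ cross u x := by
  have hconv : Convex ℝ {x | c ≤ cross u x} := by
    simpa only [crossLin_apply] using convex_halfSpace_ge (crossLin u).isLinear c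
  refine convexHull_min ?_ hconv hx
  rintro _ ⟨s, hs, rfl⟩
  exact h s hs

lemma exists_cross_neg {Δ : Set (Fin 2 → ℝ)} (h₀ : (0 : Fin 2 → ℝ) ∈ interior Δ)
    {u : Fin 2 → ℝ} (hu : u ≠ 0) : ∃ x ∈ Δ, cross u x < 0 := by
  have hcont : Continuous fun t : ℝ => t • (![u 1, -u 0] : Fin 2 → ℝ) := by fun_prop
  have hmem : ∀ᶠ t : ℝ in nhds 0, t • (![u 1, -u 0] : Fin 2 → ℝ) ∈ Δ := by
    apply hcont.continuousAt.eventually_mem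
    simpa using mem_interior_iff_mem_nhds.1 h₀
  obtain ⟨t, ht, hpos⟩ :=
    ((hmem.filter_mono nhdsWithin_le_nhds).and (self_mem_nhdsWithin (s := Set.Ioi (0 : ℝ)))).exists
  refine ⟨_, ht, ?_⟩
  have hpos' : 0 < u 0 ^ 2 + u 1 ^ 2 := by
    by_contra! hle
    refine hu ?_
    ext i
    fin_cases i <;> simp <;> nlinarith [sq_nonneg (u 0), sq_nonneg (u 1)]
  have : 0 < t * (u 0 ^ 2 + u 1 ^ 2) := mul_pos hpos hpos'
  simp [cross]
  linarith

lemma exists_mem_cross_neg {S : Set (ℤ × ℤ)} (h₀ : (0 : Fin 2 → ℝ) ∈ interior (hull S))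
    {u : Fin 2 → ℝ} (hu : u ≠ 0) : ∃ s ∈ S, cross u (toReal s) < 0 := by
  by_contra! h
  obtain ⟨x, hx, hneg⟩ := exists_cross_neg h₀ hu
  linarith [le_cross_of_mem_hull h hx]

/-- The supporting lines of a reflexive polygon through two of its points are given by primitive
integer vectors. -/
lemma exists_edge_of_support {Δ : Set (Fin 2 → ℝ)} (hΔ : IsReflexive Δ) {u q v : Fin 2 → ℝ}
    (hu : u ≠ 0) (hq : q ∈ Δ) (hv : v ∈ Δ) (hqv : q ≠ v) (hsupp : ∀ x ∈ Δ, cross u q ≤ cross u x)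
    (heq : cross u v = cross u q) : ∃ d : ℤ × ℤ, cross (toReal d) q = -1 ∧
      cross (toReal d) v = -1 ∧ ∀ x ∈ Δ, -1 ≤ cross (toReal d) x := by
  set F := {x ∈ Δ | dotp x ![u 1, -u 0] = -cross u q} with hF
  have hcross : ∀ x, dotp x ![u 1, -u 0] = -cross u x := fun x => by
    simp [dotp, cross, Fin.sum_univ_two]; ring
  have hqF : q ∈ F := ⟨hq, hcross q⟩
  have hvF : v ∈ F := ⟨hv, by rw [hcross, heq]⟩
  have hne : ∀ e : Fin 2 → ℝ, e ≠ 0 → ∀ k : ℝ, k * e 0 = 0 → k * e 1 = 0 → k = 0 := by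
    intro e he k h₀ h₁
    by_contra hk
    refine he ?_
    ext i
    fin_cases i
    · simpa [hk] using h₀
    · simpa [hk] using h₁
  have hface : IsFaceOf F Δ := by
    refine ⟨⟨q, hqF⟩, ![u 1, -u 0], -cross u q, fun x hx => ?_, hF⟩
    rw [hcross]
    linarith [hsupp x hx]
  have hdim : faceDim F + 1 = 2 := by
    have hle : vectorSpan ℝ F ≤ LinearMap.ker (crossLin u) := by
      rw [vectorSpan_def, Submodule.span_le]
      rintro _ ⟨x, hx, y, hy, rfl⟩
      have h₁ := hcross x ▸ hx.2
      have h₂ := hcross y ▸ hy.2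
      simp only [SetLike.mem_coe, LinearMap.mem_ker, vsub_eq_sub, map_sub, crossLin_apply]
      linarith
    have hker : LinearMap.ker (crossLin u) < ⊤ := by
      rw [lt_top_iff_ne_top, Ne, LinearMap.ker_eq_top]
      intro h
      obtain ⟨x, -, hx⟩ := exists_cross_neg hΔ.2.1 hu
      rw [← crossLin_apply, h] at hx
      simp at hx
    have h₁ := Submodule.finrank_lt (hle.trans_lt hker).ne
    have h₂ : 0 < Module.finrank ℝ (vectorSpan ℝ F) := by
      rw [Module.finrank_pos_iff_exists_ne_zero]
      exact ⟨⟨q - v, vsub_mem_vectorSpan ℝ hqF hvF⟩, by simpa [sub_eq_zero] using hqv⟩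
    simp only [Module.finrank_fin_fun] at h₁
    unfold faceDim
    omega
  obtain ⟨l, hl⟩ := hΔ.2.2 F hface hdim
  have hlcross : ∀ x, dotp x (fun i => (l i : ℝ)) = cross (toReal (l 1, -l 0)) x := fun x => by
    simp [dotp, cross, Fin.sum_univ_two]; ring
  have hdq : cross (toReal (l 1, -l 0)) q = -1 := hlcross q ▸ hl hqF
  have hdv : cross (toReal (l 1, -l 0)) v = -1 := hlcross v ▸ hl hvF
  refine ⟨(l 1, -l 0), hdq, hdv, fun x hx => ?_⟩
  generalize toReal (l 1, -l 0) = d at hdq hdv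
  have hdu : cross d u = 0 := by
    refine hne (v - q) (sub_ne_zero.2 hqv.symm) _ ?_ ?_ <;> simp only [cross, Pi.sub_apply] at *
    · linear_combination u 0 * (hdv - hdq) - d 0 * heq
    · linear_combination u 1 * (hdv - hdq) - d 1 * heq
  obtain ⟨y, hy, hneg⟩ := exists_cross_neg hΔ.2.1 hu
  have hprod : cross d x * cross u q = -cross u x := by
    simp only [cross] at *
    linear_combination (x 0 * q 1 - x 1 * q 0) * hdu + (u 0 * x 1 - u 1 * x 0) * hdq
  nlinarith [hsupp x hx, hsupp y hy]

/-- Every boundary point of a reflexive polygon lies on an edge. -/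
lemma exists_edge {T : Set (ℤ × ℤ)} (hT : IsReflexive (hull T)) (hfin : T.Finite)
    {u q : Fin 2 → ℝ} (hu : u ≠ 0) (hq : q ∈ hull T) (hsupp : ∀ x ∈ hull T, cross u q ≤ cross u x) :
    ∃ d : ℤ × ℤ, cross (toReal d) q = -1 ∧ (∀ s ∈ T, -1 ≤ det d s) ∧
      ∃ v ∈ T, toReal v ≠ q ∧ det d v = -1 := by
  suffices h : ∃ w : Fin 2 → ℝ, w ≠ 0 ∧ (∀ x ∈ hull T, cross w q ≤ cross w x) ∧
      ∃ v ∈ T, toReal v ≠ q ∧ cross w (toReal v) = cross w q by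
    obtain ⟨w, hw, hw', v, hv, hvq, heq⟩ := h
    obtain ⟨d, hdq, hdv, hd⟩ :=
      exists_edge_of_support hT hw hq (toReal_mem_hull hv) hvq.symm hw' heq
    rw [cross_toReal] at hdv
    refine ⟨d, hdq, fun s hs => ?_, v, hv, hvq, by exact_mod_cast hdv⟩
    have := hd _ (toReal_mem_hull hs)
    rw [cross_toReal] at this
    exact_mod_cast this
  by_cases hex : ∃ v ∈ T, toReal v ≠ q ∧ cross u (toReal v) = cross u q
  · exact ⟨u, hu, hsupp, hex⟩
  push Not at hex
  set e : ℤ × ℤ → ℝ := fun v => cross u (toReal v) - cross u q with he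
  set g : ℤ × ℤ → ℝ := fun v => u 0 * (v.1 - q 0) + u 1 * (v.2 - q 1) with hg
  have hneg : -u ≠ 0 := neg_ne_zero.2 hu
  obtain ⟨v, hv, hvneg⟩ := exists_mem_cross_neg hT.2.1 hneg
  have hq₀ : cross u q ≤ 0 := by
    simpa [cross] using hsupp 0 (interior_subset hT.2.1)
  have hve : 0 < e v := by
    simp only [cross, Pi.neg_apply, he] at *
    linarith
  obtain ⟨v₀, ⟨hv₀, hpos⟩, hmax⟩ := Set.exists_max_image {v ∈ T | 0 < e v} (fun v => g v / e v)
    (hfin.subset (Set.sep_subset _ _)) ⟨v, hv, hve⟩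
  set M := g v₀ / e v₀ with hM
  have hMe : M * e v₀ = g v₀ := div_mul_cancel₀ _ hpos.ne'
  set w : Fin 2 → ℝ := ![M * u 0 - u 1, M * u 1 + u 0] with hw
  have hcross : ∀ s, cross w (toReal s) = cross w q + (M * e s - g s) := fun s => by
    simp [cross, hw, he, hg]; ring
  refine ⟨w, fun hw₀ => hu ?_, fun x hx => ?_, v₀, hv₀, ?_, ?_⟩
  · have h₀ : M * u 0 - u 1 = 0 := congrFun hw₀ 0
    have h₁ : M * u 1 + u 0 = 0 := congrFun hw₀ 1
    have h₂ : (M ^ 2 + 1) * u 0 = 0 := by linear_combination M * h₀ + h₁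
    have h₃ : (M ^ 2 + 1) * u 1 = 0 := by linear_combination M * h₁ - h₀
    have h₄ : M ^ 2 + 1 ≠ 0 := by positivity
    ext i
    fin_cases i
    · simpa [h₄] using h₂
    · simpa [h₄] using h₃
  · refine le_cross_of_mem_hull (fun s hs => ?_) hx
    rw [hcross]
    rcases (sub_nonneg.2 (hsupp _ (toReal_mem_hull hs))).eq_or_lt with h | h
    · have hsq : toReal s = q := by
        by_contra hne
        exact hex s hs hne (by linarith)
      simp [he, hg, ← hsq]
    · have := (div_le_iff₀ h).1 (hmax s ⟨hs, h⟩)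
      simp only [he] at *
      linarith
  · rintro rfl
    simp [he] at hpos
  · rw [hcross, hMe, sub_self, add_zero]

/-- In every direction, some edge of a reflexive polygon faces that direction. -/
lemma exists_edge_facing {T : Set (ℤ × ℤ)} (hT : IsReflexive (hull T)) (hfin : T.Finite)
    {z : ℤ × ℤ} (hz : z ≠ 0) : ∃ d : ℤ × ℤ, (∀ s ∈ T, -1 ≤ det d s) ∧ det d z ≤ -1 := by
  have hz' : toReal z ≠ 0 := fun h => hz (toReal_injective (h.trans toReal_zero.symm))
  have hcomp : IsCompact (hull T) := (hfin.image toReal).isCompact_convexHull ℝ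
  have hconv := convex_hull T
  have hemb : Topology.IsClosedEmbedding fun t : ℝ => t • toReal z :=
    isClosedEmbedding_smul_left hz'
  obtain ⟨t, ht, hmax⟩ := (hemb.isCompact_preimage hcomp).exists_isMaxOn
    ⟨0, by simpa using interior_subset hT.2.1⟩ continuousOn_id
  have hcont : Continuous fun s : ℝ => s • toReal z := hemb.continuous
  have hout : ∀ s : ℝ, s • toReal z ∈ interior (hull T) → s < t := by
    intro s hs
    have hmem : ∀ᶠ r : ℝ in nhds s, r • toReal z ∈ hull T :=
      hcont.continuousAt.eventually_mem (mem_interior_iff_mem_nhds.1 hs)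
    obtain ⟨r, hr, hlt⟩ :=
      ((hmem.filter_mono nhdsWithin_le_nhds).and (self_mem_nhdsWithin (s := Set.Ioi s))).exists
    exact lt_of_lt_of_le hlt (hmax hr)
  have htpos : 0 < t := hout 0 (by simpa using hT.2.1)
  obtain ⟨f, hf⟩ := geometric_hahn_banach_open_point hconv.interior isOpen_interior
    fun h => (hout t h).false
  set u : Fin 2 → ℝ := ![-f ![0, 1], f ![1, 0]] with hu
  have hcross : ∀ x, cross u x = -f x := fun x => by
    have hx : x = x 0 • ![1, 0] + x 1 • ![0, 1] := by ext i; fin_cases i <;> simp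
    conv_rhs => rw [hx, map_add, map_smul, map_smul]
    simp [cross, hu]; ring
  have hsupp : ∀ x ∈ hull T, cross u (t • toReal z) ≤ cross u x := by
    intro x hx
    rw [hcross, hcross, neg_le_neg_iff]
    have hx' : x ∈ closure (interior (hull T)) := by
      rw [hconv.closure_interior_eq_closure_of_nonempty_interior ⟨0, hT.2.1⟩]
      exact subset_closure hx
    exact closure_minimal (fun y hy => (hf y hy).le)
      (isClosed_le f.continuous continuous_const) hx'
  have hu₀ : u ≠ 0 := by
    intro h
    have h₁ := hf 0 hT.2.1
    have h₂ := hcross (t • toReal z)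
    simp only [h, cross, Pi.zero_apply, zero_mul, sub_zero, map_zero] at h₁ h₂
    linarith
  obtain ⟨d, hd, hd', -⟩ := exists_edge hT hfin hu₀ ht hsupp
  refine ⟨d, hd', ?_⟩
  have hprod : t * (det d z : ℝ) = -1 := by
    rw [← hd, ← cross_toReal]
    simp [cross]; ring
  have hlt : (det d z : ℝ) < 0 := by
    by_contra! h
    linarith [mul_nonneg htpos.le h]
  have hlt' : det d z < 0 := by exact_mod_cast hlt
  omega

/-! ### Walking around a reflexive polygon -/

/-- A lattice polygon is the hull of the finite set of its lattice points. -/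
lemma exists_eq_hull {Δ : Set (Fin 2 → ℝ)} (hΔ : IsLatticePolytope Δ) :
    ∃ T : Set (ℤ × ℤ), T.Finite ∧ Δ = hull T ∧ ∀ s, toReal s ∈ hull T → s ∈ T := by
  obtain ⟨V, hfin, hV, rfl⟩ := hΔ
  set T : Set (ℤ × ℤ) := {s | toReal s ∈ convexHull ℝ V} with hT
  have hVT : V ⊆ toReal '' T := by
    intro v hv
    obtain ⟨a, ha⟩ := hV v hv 0
    obtain ⟨b, hb⟩ := hV v hv 1
    have hab : toReal (a, b) = v := by
      ext i
      fin_cases i <;> simp [ha, hb]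
    exact ⟨(a, b), by simpa [hT, hab] using subset_convexHull ℝ V hv, hab⟩
  have heq : convexHull ℝ V = hull T := by
    refine Set.Subset.antisymm (convexHull_mono hVT) (convexHull_min ?_ (convex_convexHull ℝ V))
    rintro _ ⟨s, hs, rfl⟩
    exact hs
  refine ⟨T, ?_, heq, fun s hs => heq.superset hs⟩
  obtain ⟨R, hR⟩ := (hfin.isCompact_convexHull ℝ).isBounded.exists_norm_le
  have hbound : ∀ k : ℤ, |(k : ℝ)| ≤ R → k ∈ Set.Icc (-⌈R⌉) ⌈R⌉ := by
    intro k hk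
    have h := abs_le.1 (hk.trans (Int.le_ceil R))
    exact ⟨by exact_mod_cast h.1, by exact_mod_cast h.2⟩
  refine ((Set.finite_Icc (-⌈R⌉) ⌈R⌉).prod (Set.finite_Icc (-⌈R⌉) ⌈R⌉)).subset fun s hs => ?_
  have hs' := hR _ hs
  exact ⟨hbound _ ((norm_le_pi_norm (toReal s) 0).trans hs'),
    hbound _ ((norm_le_pi_norm (toReal s) 1).trans hs')⟩

lemma mem_of_segment {T : Set (ℤ × ℤ)} (hsat : ∀ s, toReal s ∈ hull T → s ∈ T) {p d : ℤ × ℤ}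
    {k : ℤ} (hk : 1 ≤ k) (hp : p ∈ T) (hq : (p.1 + k * d.1, p.2 + k * d.2) ∈ T) :
    (p.1 + d.1, p.2 + d.2) ∈ T := by
  have hk' : (1 : ℝ) ≤ k := by exact_mod_cast hk
  have hk₀ : (k : ℝ) ≠ 0 := by positivity
  refine hsat _ ?_
  have h := convex_hull T (toReal_mem_hull hp) (toReal_mem_hull hq)
    (a := 1 - 1 / k) (b := 1 / k) (sub_nonneg.2 ((div_le_one₀ (by positivity)).2 hk'))
    (by positivity) (by ring)
  convert h using 1
  ext i
  fin_cases i <;> simp <;> field_simp <;> ring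

lemma exists_mem_det_pos {T : Set (ℤ × ℤ)} (h₀ : (0 : Fin 2 → ℝ) ∈ interior (hull T)) {z : ℤ × ℤ}
    (hz : z ≠ 0) : ∃ s ∈ T, 1 ≤ det z s := by
  have hz' : toReal (-z) ≠ 0 := fun h =>
    hz (neg_eq_zero.1 (toReal_injective (h.trans toReal_zero.symm)))
  obtain ⟨s, hs, hneg⟩ := exists_mem_cross_neg h₀ hz'
  rw [cross_toReal] at hneg
  have hneg' : det (-z) s < 0 := by exact_mod_cast hneg
  refine ⟨s, hs, ?_⟩
  simp only [det, Prod.fst_neg, Prod.snd_neg] at *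
  linarith

lemma ne_zero_of_det_eq_one {p q : ℤ × ℤ} (h : det p q = 1) : p ≠ 0 ∧ q ≠ 0 := by
  constructor <;> rintro rfl <;> simp [det] at h

lemma edge_short {T : Set (ℤ × ℤ)} (hT : IsReflexive (hull T)) (hfin : T.Finite) {p d : ℤ × ℤ}
    (hp : p ∈ T) (hpd : det p d = 1) : (p.1 + 5 * d.1, p.2 + 5 * d.2) ∉ T := by
  intro hq
  have hd := (ne_zero_of_det_eq_one hpd).2
  obtain ⟨e, he, hed⟩ := exists_edge_facing hT hfin hd
  obtain ⟨f, hf, hfd⟩ := exists_edge_facing hT hfin (neg_ne_zero.2 hd)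
  obtain ⟨w, hw, hs⟩ := exists_mem_det_pos hT.2.1 hd
  have hw₁ : w.1 = det d w * -p.1 + det p w * d.1 := by
    simp only [det] at *
    linear_combination -w.1 * hpd
  have hw₂ : w.2 = det d w * -p.2 + det p w * d.2 := by
    simp only [det] at *
    linear_combination -w.2 * hpd
  generalize det d w = s at *
  generalize det p w = b at *
  have hew : det e w = -s * det e p + b * det e d := by
    simp only [det, hw₁, hw₂]; ring
  have hfw : det f w = -s * det f p - b * det f (-d) := by
    simp only [det, hw₁, hw₂, Prod.fst_neg, Prod.snd_neg]; ring
  have heq : det e (p.1 + 5 * d.1, p.2 + 5 * d.2) = det e p + 5 * det e d := by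
    simp only [det]; ring
  have h₁ := he _ hq
  have h₂ := he w hw
  have h₃ := hf p hp
  have h₄ := hf w hw
  rw [heq] at h₁
  rw [hew] at h₂
  rw [hfw] at h₄
  generalize det e p = ep at *
  generalize det f p = fp at *
  obtain ⟨x, hx⟩ : ∃ x, det e d = -x := ⟨_, (neg_neg _).symm⟩
  obtain ⟨y, hy⟩ : ∃ y, det f (-d) = -y := ⟨_, (neg_neg _).symm⟩
  rw [hx] at hed h₁ h₂
  rw [hy] at hfd h₄
  have hxb : x * (b + 4 * s - 1) ≤ 0 := by nlinarith
  have hyb : 0 ≤ y * (b + 1 + s) := by nlinarith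
  have hb₁ : b + 4 * s - 1 ≤ 0 := nonpos_of_mul_nonpos_right hxb (by omega)
  have hb₂ : 0 ≤ b + 1 + s := nonneg_of_mul_nonneg_right hyb (by omega)
  omega

lemma exists_next {T : Set (ℤ × ℤ)} (hT : IsReflexive (hull T)) (hfin : T.Finite)
    (hsat : ∀ s, toReal s ∈ hull T → s ∈ T) {p q : ℤ × ℤ} (hp : p ∈ T) (hq : q ∈ T)
    (hpq : det p q = 1) (hhalf : ∀ s ∈ T, -1 ≤ det (q.1 - p.1, q.2 - p.2) s) :
    ∃ a ∈ [-2, -1, 0, 1, 2], (a * q.1 - p.1, a * q.2 - p.2) ∈ T ∧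
      ∀ s ∈ T, -1 ≤ det (a * q.1 - p.1 - q.1, a * q.2 - p.2 - q.2) s := by
  have hq₀ := (ne_zero_of_det_eq_one hpq).2
  obtain ⟨v, hv, hvpos⟩ := exists_mem_det_pos hT.2.1 hq₀
  obtain ⟨w, ⟨hw, hwpos⟩, hmax⟩ := Set.exists_max_image {v ∈ T | 1 ≤ det q v}
    (fun v => ((det p v - 1 : ℤ) : ℝ) / (det q v : ℤ)) (hfin.subset (Set.sep_subset _ _))
    ⟨v, hv, hvpos⟩
  set M := ((det p w - 1 : ℤ) : ℝ) / (det q w : ℤ) with hM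
  have hwpos' : (0 : ℝ) < det q w := by exact_mod_cast hwpos
  have hMw : M * det q w = det p w - 1 := by
    rw [hM, div_mul_cancel₀ _ hwpos'.ne']
    push_cast
    ring
  have hhalf' : ∀ s ∈ T, (det p s - 1 : ℝ) ≤ det q s := by
    intro s hs
    have h := hhalf s hs
    have heq : det (q.1 - p.1, q.2 - p.2) s = det q s - det p s := by simp only [det]; ring
    rw [heq] at h
    exact_mod_cast (by linarith : det p s - 1 ≤ det q s)
  have hM₁ : M ≤ 1 := by
    rw [hM, div_le_one₀ hwpos']
    push_cast
    exact hhalf' w hw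
  set u : Fin 2 → ℝ := ![M * q.1 - p.1, M * q.2 - p.2] with hu
  have hcross : ∀ s, cross u (toReal s) = M * det q s - det p s := fun s => by
    simp [cross, det, hu]; ring
  have hcq : cross u (toReal q) = -1 := by
    rw [hcross, hpq]
    simp [det, mul_comm]
  have hu₀ : u ≠ 0 := by
    intro h
    simp [h, cross] at hcq
  obtain ⟨e, heq, hew, he⟩ := exists_edge_of_support hT hu₀ (toReal_mem_hull hq)
    (toReal_mem_hull hw)
    (fun h => by
      rw [toReal_injective h] at hwpos
      simp [det, mul_comm] at hwpos)
    (fun x hx => by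
      rw [hcq]
      refine le_cross_of_mem_hull (fun s hs => ?_) hx
      rw [hcross]
      by_cases hpos : 1 ≤ det q s
      · have hpos' : (0 : ℝ) < det q s := by exact_mod_cast hpos
        have h := (div_le_iff₀ hpos').1 (hmax s ⟨hs, hpos⟩)
        push_cast at h
        linarith
      · have hneg : (det q s : ℝ) ≤ 0 := by exact_mod_cast (by omega : det q s ≤ 0)
        nlinarith [hhalf' s hs])
    (by rw [hcq, hcross, hMw]; ring)
  rw [cross_toReal] at heq hew
  replace heq : det e q = -1 := by exact_mod_cast heq
  replace hew : det e w = -1 := by exact_mod_cast hew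
  have he' : ∀ s ∈ T, -1 ≤ det e s := fun s hs => by
    have h := he _ (toReal_mem_hull hs)
    rw [cross_toReal] at h
    exact_mod_cast h
  obtain ⟨a, ha⟩ : ∃ a, det e p = 1 - a := ⟨1 - det e p, by ring⟩
  have he₁ : a * q.1 - p.1 - q.1 = e.1 := by
    simp only [det] at *
    linear_combination q.1 * ha - p.1 * heq + e.1 * hpq
  have he₂ : a * q.2 - p.2 - q.2 = e.2 := by
    simp only [det] at *
    linear_combination q.2 * ha - p.2 * heq + e.2 * hpq
  have hw₁ : w.1 = q.1 + det q w * e.1 := by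
    simp only [det] at *
    linear_combination q.1 * (-hew) + (-w.1) * (-heq)
  have hw₂ : w.2 = q.2 + det q w * e.2 := by
    simp only [det] at *
    linear_combination q.2 * (-hew) + (-w.2) * (-heq)
  have hr : (a * q.1 - p.1, a * q.2 - p.2) ∈ T := by
    have hw' : (q.1 + det q w * e.1, q.2 + det q w * e.2) ∈ T := by
      rwa [← hw₁, ← hw₂]
    convert mem_of_segment hsat hwpos hq hw' using 2 <;> linarith
  refine ⟨a, ?_, hr, fun s hs => ?_⟩
  · obtain ⟨f, hf, hfq⟩ := exists_edge_facing hT hfin (neg_ne_zero.2 hq₀)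
    have h₁ := he' p hp
    have h₂ := hf p hp
    have h₃ := hf _ hr
    have h₄ : det f (a * q.1 - p.1, a * q.2 - p.2) = -(a * det f (-q)) - det f p := by
      simp only [det, Prod.fst_neg, Prod.snd_neg]; ring
    rw [h₄] at h₃
    have h₅ : -2 ≤ a := by
      by_contra! h
      nlinarith
    have h₆ : a ≤ 2 := by omega
    interval_cases a <;> simp
  · rw [he₁, he₂]
    exact he' s hs

lemma isWalkable {T : Set (ℤ × ℤ)} (hT : IsReflexive (hull T)) (hfin : T.Finite)
    (hsat : ∀ s, toReal s ∈ hull T → s ∈ T) : IsWalkable T where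
  short _ hp _ hpd _ := edge_short hT hfin hp hpd
  next _ hp _ hq hpq hhalf := exists_next hT hfin hsat hp hq hpq hhalf

lemma exists_start {T : Set (ℤ × ℤ)} (hT : IsReflexive (hull T)) (hfin : T.Finite)
    (hsat : ∀ s, toReal s ∈ hull T → s ∈ T) : ∃ p ∈ T, ∃ q ∈ T, det p q = 1 ∧
      ∀ s ∈ T, -1 ≤ det (q.1 - p.1, q.2 - p.2) s := by
  set u : Fin 2 → ℝ := toReal (0, 1)
  have hu : u ≠ 0 := fun h => by simpa [u] using congrFun h 1
  obtain ⟨v, hv, -⟩ := exists_mem_cross_neg hT.2.1 hu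
  obtain ⟨q, hq, hmin⟩ := Set.exists_min_image T (fun s => cross u (toReal s)) hfin ⟨v, hv⟩
  obtain ⟨d, hdq, hd, v, hv, hvq, hdv⟩ := exists_edge hT hfin hu (toReal_mem_hull hq)
    fun x hx => le_cross_of_mem_hull hmin hx
  rw [cross_toReal] at hdq
  replace hdq : det d q = -1 := by exact_mod_cast hdq
  have hv₁ : v.1 = q.1 + det q v * d.1 := by
    simp only [det] at *
    linear_combination q.1 * (-hdv) + (-v.1) * (-hdq)
  have hv₂ : v.2 = q.2 + det q v * d.2 := by
    simp only [det] at *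
    linear_combination q.2 * (-hdv) + (-v.2) * (-hdq)
  have hfinish : ∀ p ∈ T, det d p = -1 → ∀ k, 1 ≤ k → (p.1 + k * d.1, p.2 + k * d.2) ∈ T →
      ∃ p ∈ T, ∃ q ∈ T, det p q = 1 ∧ ∀ s ∈ T, -1 ≤ det (q.1 - p.1, q.2 - p.2) s := by
    intro p hp hdp k hk hpk
    refine ⟨p, hp, _, mem_of_segment hsat hk hp hpk, ?_, ?_⟩
    · simp only [det] at *
      linarith
    · simpa using hd
  rcases lt_trichotomy (det q v) 0 with h | h | h
  · refine hfinish v hv hdv (-det q v) (by omega) ?_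
    convert hq using 1
    ext <;> linarith
  · refine absurd ?_ hvq
    congr 1
    ext
    · simpa [h] using hv₁
    · simpa [h] using hv₂
  · refine hfinish q hq hdq (det q v) (by omega) ?_
    rwa [← hv₁, ← hv₂]

/-! ### Unimodular maps -/

lemma det_combo (p q s t : ℤ × ℤ) : det (combo p q s) (combo p q t) = det p q * det s t := by
  simp only [det, combo]; ring

lemma combo_combo (p q p' q' s : ℤ × ℤ) :
    combo p q (combo p' q' s) = combo (combo p q p') (combo p q q') s := by
  ext <;> simp only [combo] <;> ring

lemma combo_surjective {p q : ℤ × ℤ} (h : IsUnit (det p q)) : Function.Surjective (combo p q) := by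
  intro t
  have hsq := Int.isUnit_mul_self h
  refine ⟨(det p q * det t q, det p q * det p t), ?_⟩
  generalize hk : det p q = k at *
  simp only [det] at hk
  ext <;> simp only [combo, det]
  · linear_combination k * t.1 * hk + t.1 * hsq
  · linear_combination k * t.2 * hk + t.2 * hsq

lemma IsWalkable.preimage_combo {T : Set (ℤ × ℤ)} (hT : IsWalkable T) {p q : ℤ × ℤ}
    (hpq : det p q = 1) : IsWalkable (combo p q ⁻¹' T) := by
  have hdet : ∀ s t, det (combo p q s) (combo p q t) = det s t := fun s t => by
    rw [det_combo, hpq, one_mul]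
  have hsurj := combo_surjective (hpq ▸ isUnit_one)
  have hhalf : ∀ d, (∀ s ∈ combo p q ⁻¹' T, -1 ≤ det d s) ↔ ∀ s ∈ T, -1 ≤ det (combo p q d) s := by
    intro d
    rw [hsurj.forall (p := fun s => s ∈ T → -1 ≤ det (combo p q d) s)]
    simp only [Set.mem_preimage, hdet]
  constructor
  · intro r hr d hrd hd
    convert hT.short _ hr (combo p q d) (by rwa [hdet]) ((hhalf d).1 hd) using 1
    rw [Set.mem_preimage]
    congr! 1
    ext <;> simp only [combo] <;> ring
  · intro r hr s hs hrs hd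
    rw [hhalf] at hd
    obtain ⟨a, ha, hmem, hnext⟩ := hT.next _ hr _ hs (by rwa [hdet]) (by
      convert hd using 4
      ext <;> simp only [combo] <;> ring)
    refine ⟨a, ha, ?_, (hhalf _).2 ?_⟩
    · rw [Set.mem_preimage]
      convert hmem using 1
      ext <;> simp only [combo] <;> ring
    · convert hnext using 4
      ext <;> simp only [combo] <;> ring

lemma mulVec_toReal (A : Matrix (Fin 2) (Fin 2) ℤ) (s : ℤ × ℤ) :
    (A.map (fun z : ℤ => (z : ℝ))).mulVec (toReal s) =
      toReal (combo (A 0 0, A 1 0) (A 0 1, A 1 1) s) := by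
  ext i
  fin_cases i <;> simp [Matrix.mulVec, dotProduct, Fin.sum_univ_two, combo, mul_comm]

lemma image_mulVec_hull (A : Matrix (Fin 2) (Fin 2) ℤ) (S : Set (ℤ × ℤ)) :
    (fun x => (A.map (fun z : ℤ => (z : ℝ))).mulVec x) '' hull S =
      hull (combo (A 0 0, A 1 0) (A 0 1, A 1 1) '' S) := by
  have h := (A.map (fun z : ℤ => (z : ℝ))).mulVecLin.image_convexHull (toReal '' S)
  simp only [Matrix.coe_mulVecLin] at h
  rw [hull, h, hull, Set.image_image, Set.image_image]
  simp only [mulVec_toReal]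

lemma det_matrix (A : Matrix (Fin 2) (Fin 2) ℤ) :
    A.det = det (A 0 0, A 1 0) (A 0 1, A 1 1) := by
  rw [Matrix.det_fin_two, det]; ring

/-- A unimodular equivalence between lattice polygons restricts to their lattice points. -/
lemma exists_combo_of_unimodEquiv {S S' : Set (ℤ × ℤ)} (hS : ∀ s, toReal s ∈ hull S → s ∈ S)
    (hS' : ∀ s, toReal s ∈ hull S' → s ∈ S') (h : UnimodEquiv (hull S) (hull S')) :
    ∃ p q, IsUnit (det p q) ∧ combo p q '' S = S' := by
  obtain ⟨A, hA, heq⟩ := h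
  rw [det_matrix] at hA
  rw [image_mulVec_hull] at heq
  refine ⟨_, _, hA, Set.Subset.antisymm ?_ ?_⟩
  · rintro _ ⟨s, hs, rfl⟩
    exact hS' _ (heq ▸ toReal_mem_hull ⟨s, hs, rfl⟩)
  · intro t ht
    obtain ⟨s, rfl⟩ := combo_surjective hA t
    have hs : toReal (combo (A 0 0, A 1 0) (A 0 1, A 1 1) s) ∈
        (fun x => (A.map (fun z : ℤ => (z : ℝ))).mulVec x) '' hull S := by
      rw [image_mulVec_hull, ← heq]
      exact toReal_mem_hull ht
    obtain ⟨x, hx, hxs⟩ := hs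
    rw [← mulVec_toReal] at hxs
    have hinj : Function.Injective (A.map (fun z : ℤ => (z : ℝ))).mulVec := by
      rw [Matrix.mulVec_injective_iff_isUnit, Matrix.isUnit_iff_isUnit_det]
      rw [← det_matrix] at hA
      have hmap : (A.map (fun z : ℤ => (z : ℝ))).det = (A.det : ℝ) :=
        ((Int.castRingHom ℝ).map_det A).symm
      rw [hmap]
      exact hA.map (Int.castRingHom ℝ)
    exact ⟨s, hS s (hinj hxs ▸ hx), rfl⟩

/-- Every reflexive polygon is equivalent to one of the representatives. -/
lemma exists_unimodEquiv {Δ : Set (Fin 2 → ℝ)} (hΔ : IsReflexive Δ) :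
    ∃ c ∈ boundaries, UnimodEquiv (hull {s | s ∈ (0, 0) :: c}) Δ := by
  obtain ⟨T, hfin, rfl, hsat⟩ := exists_eq_hull hΔ.1
  obtain ⟨p, hp, q, hq, hpq, hhalf⟩ := exists_start hΔ hfin hsat
  have h₀ : (0, 0) ∈ T := hsat _ (by
    rw [show ((0, 0) : ℤ × ℤ) = 0 from rfl, toReal_zero]
    exact interior_subset hΔ.2.1)
  have hp' : combo p q (1, 0) ∈ T := by simpa [combo] using hp
  have hhalf' : ∀ s ∈ combo p q ⁻¹' T, -1 ≤ det (-1, 1) s := by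
    intro s hs
    convert hhalf _ hs using 1
    simp only [det, combo] at *
    linear_combination (s.1 + s.2) * hpq
  obtain ⟨c, hc, r, s, hrs, himg⟩ := exists_equivalent_of_search
    ((isWalkable hΔ hfin hsat).preimage_combo hpq) 10 search_eq_true hp'
    (by simpa [combo] using hq) (by simp [det]) (by simpa using hhalf')
    (by
      intro t ht
      simp only [List.mem_cons, List.not_mem_nil, or_false] at ht
      rcases ht with rfl | rfl
      · exact hp'
      · simpa [combo] using h₀)
    (by simpa using hhalf')
  refine ⟨c, hc, !![(combo p q r).1, (combo p q s).1; (combo p q r).2, (combo p q s).2], ?_, ?_⟩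
  · rw [det_matrix]
    simpa [det_combo, hpq] using hrs
  · rw [image_mulVec_hull, ← Set.image_preimage_eq T (combo_surjective (hpq ▸ isUnit_one)), ← himg,
      Set.image_image]
    simp [combo_combo]

/-! ### The representatives are reflexive and pairwise inequivalent -/

lemma exists_eq_smul_of_cross_eq_zero {e w : Fin 2 → ℝ} (he : e ≠ 0) (h : cross w e = 0) :
    ∃ k : ℝ, w = k • e := by
  have hpos : e 0 ^ 2 + e 1 ^ 2 ≠ 0 := by
    intro hsum
    refine he ?_
    ext i
    fin_cases i <;> simp <;> nlinarith [sq_nonneg (e 0), sq_nonneg (e 1)]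
  refine ⟨(w 0 * e 0 + w 1 * e 1) / (e 0 ^ 2 + e 1 ^ 2), ?_⟩
  simp only [cross] at h
  ext i
  fin_cases i <;> simp <;> field_simp
  · linear_combination e 1 * h
  · linear_combination -e 0 * h

lemma mem_hull_support {S : Set (ℤ × ℤ)} {w x : Fin 2 → ℝ} {c : ℝ}
    (hle : ∀ y ∈ hull S, cross w y ≤ c) (hx : x ∈ hull S) (hxc : cross w x = c) :
    x ∈ hull {s ∈ S | cross w (toReal s) = c} := by
  set F := hull {s ∈ S | cross w (toReal s) = c}
  have hconv : Convex ℝ {x | cross w x ≤ c ∧ (cross w x = c → x ∈ F)} := by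
    intro y ⟨hy, hyF⟩ z ⟨hz, hzF⟩ a b ha hb hab
    have hcross : cross w (a • y + b • z) = a * cross w y + b * cross w z := by
      simp [cross]; ring
    have hy' : 0 ≤ a * (c - cross w y) := mul_nonneg ha (sub_nonneg.2 hy)
    have hz' : 0 ≤ b * (c - cross w z) := mul_nonneg hb (sub_nonneg.2 hz)
    have hc : a * c + b * c = c := by rw [← add_mul, hab, one_mul]
    change cross w _ ≤ c ∧ (cross w _ = c → _)
    rw [hcross]
    refine ⟨by linarith, fun h => ?_⟩
    rcases ha.eq_or_lt with rfl | ha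
    · obtain rfl : b = 1 := by linarith
      simpa using hzF (by linarith)
    rcases hb.eq_or_lt with rfl | hb
    · obtain rfl : a = 1 := by linarith
      simpa using hyF (by linarith)
    · refine convex_hull _ (hyF ?_) (hzF ?_) ha.le hb.le hab
      · exact (sub_eq_zero.1 ((mul_eq_zero_iff_left ha.ne').1 (by linarith))).symm
      · exact (sub_eq_zero.1 ((mul_eq_zero_iff_left hb.ne').1 (by linarith))).symm
  refine (convexHull_min ?_ hconv hx).2 hxc
  rintro _ ⟨s, hs, rfl⟩
  exact ⟨hle _ (toReal_mem_hull hs), fun h => toReal_mem_hull ⟨hs, h⟩⟩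

lemma zero_mem_interior_hull {S : Set (ℤ × ℤ)} (h₁ : (1, 0) ∈ S) (h₂ : (0, 1) ∈ S) {p q : ℤ × ℤ}
    (hp : p ∈ S) (hq : q ∈ S) (hpq₁ : p.1 + q.1 < 0) (hpq₂ : p.2 + q.2 < 0) :
    (0 : Fin 2 → ℝ) ∈ interior (hull S) := by
  obtain ⟨a, ha⟩ : ∃ a : ℝ, a = -(p.1 + q.1) := ⟨_, rfl⟩
  obtain ⟨b, hb⟩ : ∃ b : ℝ, b = -(p.2 + q.2) := ⟨_, rfl⟩
  have ha₀ : 0 < a := by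
    have : (p.1 + q.1 : ℝ) < 0 := by exact_mod_cast hpq₁
    linarith
  have hb₀ : 0 < b := by
    have : (p.2 + q.2 : ℝ) < 0 := by exact_mod_cast hpq₂
    linarith
  set m : (Fin 2 → ℝ) → ℝ := fun x => (1 - x 0 - x 1) / (2 + a + b) with hm
  set U : Set (Fin 2 → ℝ) := {x | 0 < m x ∧ 0 < x 0 + m x * a ∧ 0 < x 1 + m x * b} with hU
  have hcont : Continuous m := by fun_prop
  have hopen : IsOpen U :=
    (isOpen_lt continuous_const hcont).inter
      ((isOpen_lt continuous_const (g := fun x => x 0 + m x * a) (by fun_prop)).inter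
        (isOpen_lt continuous_const (g := fun x => x 1 + m x * b) (by fun_prop)))
  refine interior_maximal (t := U) (fun x hx => ?_) hopen ?_
  · obtain ⟨hx₀, hx₁, hx₂⟩ := hx
    have hsum : m x * (2 + a + b) = 1 - x 0 - x 1 := div_mul_cancel₀ _ (by positivity)
    have hmem := (convex_hull S).sum_mem (t := Finset.univ)
      (w := ![m x, m x, x 0 + m x * a, x 1 + m x * b])
      (z := ![toReal p, toReal q, toReal (1, 0), toReal (0, 1)])
      (by intro i _; fin_cases i <;> simp <;> linarith)
      (by simp [Fin.sum_univ_four]; linarith)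
      (by intro i _; fin_cases i <;> exact toReal_mem_hull ‹_›)
    convert hmem using 1
    ext i
    fin_cases i <;> simp [Fin.sum_univ_four, ha, hb] <;> ring
  · have : 0 < m 0 := by simp [hm]; positivity
    refine ⟨this, ?_, ?_⟩ <;> simp <;> positivity

lemma faceDim_eq_two {Δ : Set (Fin 2 → ℝ)} (h₀ : (0 : Fin 2 → ℝ) ∈ interior Δ) :
    faceDim Δ = 2 := by
  have h : affineSpan ℝ Δ = ⊤ :=
    top_unique ((isOpen_interior.affineSpan_eq_top ⟨0, h₀⟩).ge.trans
      (affineSpan_mono ℝ interior_subset))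
  rw [faceDim, ← direction_affineSpan, h, AffineSubspace.direction_top, finrank_top]
  simp

lemma isReflexive_hull {c : List (ℤ × ℤ)} (h : isReflexivePath c = true) :
    IsReflexive (hull {s | s ∈ (0, 0) :: c}) := by
  set S : Set (ℤ × ℤ) := {s | s ∈ (0, 0) :: c} with hS
  simp only [isReflexivePath, Bool.and_eq_true, Bool.or_eq_true, List.all_eq_true,
    List.any_eq_true, Int.beq'_eq, Int.ble'_eq_true, Int.blt'_eq_true, mem_eq_true] at h
  obtain ⟨⟨⟨⟨⟨-, -⟩, h₁⟩, h₂⟩, p, hp, q, hq, hpq₁, hpq₂⟩, hpairs⟩ := h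
  have hcS : ∀ s ∈ c, s ∈ S := fun s hs => List.mem_cons_of_mem _ hs
  have h₀ := zero_mem_interior_hull (hcS _ h₁) (hcS _ h₂) (hcS p hp) (hcS q hq) hpq₁ hpq₂
  refine ⟨⟨toReal '' S, (List.finite_toSet _).image _, ?_, rfl⟩, h₀, ?_⟩
  · rintro _ ⟨s, -, rfl⟩ i
    fin_cases i
    · exact ⟨s.1, rfl⟩
    · exact ⟨s.2, rfl⟩
  rintro F ⟨⟨y, hy⟩, u, k, hle, hF⟩ hdim
  simp only [dotp_eq_cross _ u] at hle hF
  set w : Fin 2 → ℝ := ![u 1, -u 0]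
  have hw : w ≠ 0 := by
    intro hw
    have hz : ∀ x, cross w x = 0 := by simp [hw, cross]
    have hk : 0 = k := hz y ▸ (hF.subset hy).2
    have hF' : F = hull S := by
      rw [hF]
      simp [hz, hk]
    rw [hF', faceDim_eq_two h₀] at hdim
    omega
  have hFS : F ⊆ hull {s ∈ S | cross w (toReal s) = k} := by
    intro x hx
    rw [hF] at hx
    exact mem_hull_support hle hx.1 hx.2
  have hnt : {s ∈ S | cross w (toReal s) = k}.Nontrivial := by
    by_contra hsub
    rw [Set.not_nontrivial_iff] at hsub
    have hFsub : F.Subsingleton := by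
      refine Set.Subsingleton.anti ?_ hFS
      rw [hull]
      rcases (hsub.image toReal).eq_empty_or_singleton with h | ⟨x, h⟩ <;> simp [h]
    rw [faceDim, vectorSpan_of_subsingleton ℝ hFsub, finrank_bot] at hdim
    omega
  obtain ⟨p, ⟨hpS, hpk⟩, q, ⟨hqS, hqk⟩, hpq⟩ := hnt
  set e := toReal q - toReal p with he
  have he₀ : e ≠ 0 := sub_ne_zero.2 fun h => hpq (toReal_injective h).symm
  obtain ⟨l, hl⟩ := exists_eq_smul_of_cross_eq_zero he₀ (w := w) (by
    simp only [cross, he, Pi.sub_apply] at *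
    linarith)
  have hl₀ : l ≠ 0 := by
    rintro rfl
    exact hw (by simpa using hl)
  have hside : ∀ s ∈ c, l * (det (q.1 - p.1, q.2 - p.2) (s.1 - p.1, s.2 - p.2) : ℤ) ≤ 0 := by
    intro s hs
    have h := hle _ (toReal_mem_hull (hcS s hs))
    have heq : l * (det (q.1 - p.1, q.2 - p.2) (s.1 - p.1, s.2 - p.2) : ℤ) =
        cross w (toReal s) - cross w (toReal p) := by
      simp [hl, cross, det, he]
      ring
    linarith
  rcases hpairs p hpS q hqS with (h | ⟨d, -, hdp, hdq⟩) | ⟨⟨s, hs, hpos⟩, s', hs', hneg⟩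
  · exact absurd (List.mem_singleton.1 h).symm hpq
  · obtain ⟨l', hl'⟩ := exists_eq_smul_of_cross_eq_zero he₀ (w := toReal d) (by
      have hdp' := cross_toReal d p
      have hdq' := cross_toReal d q
      rw [hdp] at hdp'
      rw [hdq] at hdq'
      simp only [cross, he, Pi.sub_apply] at *
      linarith)
    refine ⟨![-d.2, d.1], fun x hx => ?_⟩
    have hxk : cross w x = k := (hF.subset hx).2
    have hx' : cross e x = cross e (toReal p) := by
      refine mul_left_cancel₀ hl₀ ?_
      rw [← hpk, hl] at hxk
      simp only [cross, Pi.smul_apply, smul_eq_mul] at *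
      linarith
    have hdx : dotp x (fun i => ((![-d.2, d.1] : Fin 2 → ℤ) i : ℝ)) = cross (toReal d) x := by
      simp [dotp, cross, Fin.sum_univ_two]; ring
    have hdp' := cross_toReal d p
    rw [hdp] at hdp'
    rw [Set.mem_ofPred_eq, hdx]
    push_cast at hdp'
    rw [← hdp', hl']
    simp only [cross, Pi.smul_apply, smul_eq_mul] at *
    linear_combination l' * hx'
  · have hpos' : (0 : ℝ) < (det (q.1 - p.1, q.2 - p.2) (s.1 - p.1, s.2 - p.2) : ℤ) := by
      exact_mod_cast hpos
    have hneg' : ((det (q.1 - p.1, q.2 - p.2) (s'.1 - p.1, s'.2 - p.2) : ℤ) : ℝ) < 0 := by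
      exact_mod_cast hneg
    exact absurd (le_antisymm (nonpos_of_mul_nonpos_left (hside s hs) hpos')
      (nonneg_of_mul_nonpos_left (hside s' hs') hneg')) hl₀

lemma mem_of_toReal_mem_hull {c : List (ℤ × ℤ)} (h : isReflexivePath c = true) (s : ℤ × ℤ)
    (hs : toReal s ∈ hull {s | s ∈ (0, 0) :: c}) : s ∈ (0, 0) :: c := by
  simp only [isReflexivePath, Bool.and_eq_true, List.all_eq_true, Int.ble'_eq_true] at h
  obtain ⟨⟨⟨⟨⟨h, hhalf⟩, -⟩, -⟩, -⟩, -⟩ := h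
  refine mem_of_confines h fun d hd => ?_
  have hle : (-1 : ℝ) ≤ cross (toReal d) (toReal s) := by
    refine le_cross_of_mem_hull (fun t ht => ?_) hs
    rw [cross_toReal]
    exact_mod_cast hhalf t ht d hd
  rw [cross_toReal] at hle
  exact_mod_cast hle

lemma eq_of_unimodEquiv {c c' : List (ℤ × ℤ)} (hc : c ∈ boundaries) (hc' : c' ∈ boundaries)
    (h : UnimodEquiv (hull {s | s ∈ (0, 0) :: c}) (hull {s | s ∈ (0, 0) :: c'})) : c = c' := by
  have hpath := isReflexivePath_of_mem_boundaries c hc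
  obtain ⟨p, q, hpq, himg⟩ := exists_combo_of_unimodEquiv (mem_of_toReal_mem_hull hpath)
    (mem_of_toReal_mem_hull (isReflexivePath_of_mem_boundaries c' hc')) h
  simp only [isReflexivePath, Bool.and_eq_true, mem_eq_true] at hpath
  obtain ⟨⟨⟨⟨-, h₁⟩, h₂⟩, -⟩, -⟩ := hpath
  refine eq_of_equivalent c hc c' hc' (equivalent_iff.2 ⟨p, ?_, q, ?_, hpq, himg⟩)
  · exact himg.subset ⟨(1, 0), List.mem_cons_of_mem _ h₁, by simp [combo]⟩
  · exact himg.subset ⟨(0, 1), List.mem_cons_of_mem _ h₂, by simp [combo]⟩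

lemma unimodEquiv_refl {n : ℕ} (Δ : Set (Fin n → ℝ)) : UnimodEquiv Δ Δ :=
  ⟨1, by simp, by simp [Matrix.map_one]⟩

end ReflexivePolygon

/-- Up to unimodular equivalence there exist exactly `16` two-dimensional
reflexive polytopes: there is a set of `16` reflexive polygons, pairwise inequivalent, such
that every reflexive polygon is equivalent to one of them. -/
theorem sixteen_reflexive_polygons :
    ∃ L : Finset (Set (Fin 2 → ℝ)),
      L.card = 16 ∧
      (∀ Δ ∈ L, IsReflexive Δ) ∧
      (∀ Δ : Set (Fin 2 → ℝ), IsReflexive Δ → ∃ Δ' ∈ L, UnimodEquiv Δ' Δ) ∧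
      (∀ Δ₁ ∈ L, ∀ Δ₂ ∈ L, UnimodEquiv Δ₁ Δ₂ → Δ₁ = Δ₂) := by
  classical
  let polygon (c : List (ℤ × ℤ)) := ReflexivePolygon.hull {s | s ∈ (0, 0) :: c}
  refine ⟨ReflexivePolygon.boundaries.toFinset.image polygon, ?_, ?_, ?_, ?_⟩
  · rw [Finset.card_image_of_injOn, ReflexivePolygon.card_boundaries]
    intro c hc c' hc' heq
    rw [Finset.mem_coe, List.mem_toFinset] at hc hc'
    exact ReflexivePolygon.eq_of_unimodEquiv hc hc'
      (heq ▸ ReflexivePolygon.unimodEquiv_refl (polygon c) :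
        UnimodEquiv (polygon c) (polygon c'))
  · simp only [Finset.forall_mem_image, List.mem_toFinset]
    exact fun c hc =>
      ReflexivePolygon.isReflexive_hull (ReflexivePolygon.isReflexivePath_of_mem_boundaries c hc)
  · intro Δ hΔ
    obtain ⟨c, hc, h⟩ := ReflexivePolygon.exists_unimodEquiv hΔ
    exact ⟨_, Finset.mem_image_of_mem _ (List.mem_toFinset.2 hc), h⟩
  · simp only [Finset.forall_mem_image, List.mem_toFinset]
    intro c hc c' hc' h
    rw [ReflexivePolygon.eq_of_unimodEquiv hc hc' h]
end

section
/- For every pair of positive integers n and m there exists a constant C(n, m) with the following property: if P ⊂ ℝⁿ is an n-dimensional polytope with all vertices in ℤⁿ, containing 0 in its interior, such that every facet of P lies on a hyperplane {x ∈ ℝⁿ : ⟨x, l⟩ = c} with l ∈ ℤⁿ primitive and c an integer with |c| ≤ m, then the (Lebesgue) volume of P is at most C(n, m). -/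
open Finset

/-- A conic version of Carathéodory's theorem. -/
theorem exists_subset_linearIndepOn_nonneg_sum {E : Type*} [AddCommGroup E] [Module ℝ E]
    (V : Finset E) (x : E) (f : E → ℝ) (hf : ∀ v ∈ V, 0 ≤ f v) (hx : ∑ v ∈ V, f v • v = x) :
    ∃ s ⊆ V, ∃ g : E → ℝ, (∀ v ∈ s, 0 ≤ g v) ∧ ∑ v ∈ s, g v • v = x ∧
      LinearIndepOn ℝ id (s : Set E) := by
  classical
  induction V using Finset.strongInduction generalizing f with
  | H V ih =>
  by_cases hV : LinearIndepOn ℝ id (V : Set E)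
  · exact ⟨V, Subset.rfl, f, hf, hx, hV⟩
  obtain ⟨g, hg0, hgpos⟩ : ∃ g : E → ℝ, ∑ v ∈ V, g v • v = 0 ∧ ∃ v ∈ V, 0 < g v := by
    rw [linearIndepOn_finset_iff] at hV
    push Not at hV
    obtain ⟨g, hg, v, hv, hgv⟩ := hV
    rcases hgv.lt_or_gt with h | h
    · exact ⟨-g, by simpa using hg, v, hv, by simpa using h⟩
    · exact ⟨g, by simpa using hg, v, hv, h⟩
  obtain ⟨w, hw, hmin⟩ := ({v ∈ V | 0 < g v}).exists_min_image (fun v => f v / g v)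
    (by obtain ⟨v, hv, h⟩ := hgpos; exact ⟨v, by simp [hv, h]⟩)
  obtain ⟨hwV, hgw⟩ := mem_filter.1 hw
  set k : E → ℝ := fun v => f v - f w / g w * g v with hk
  have hkw : k w = 0 := by simp [hk, hgw.ne']
  obtain ⟨s, hs, h⟩ := ih (V.erase w) (erase_ssubset hwV) k
    (fun v hv => by
      have hvV := mem_of_mem_erase hv
      have h0 : 0 ≤ f w / g w := div_nonneg (hf w hwV) hgw.le
      rcases lt_or_ge 0 (g v) with h | h
      · have := hmin v (by simp [hvV, h])
        rw [le_div_iff₀ h] at this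
        simpa [hk] using this
      · have := mul_nonpos_of_nonneg_of_nonpos h0 h
        have := hf v hvV
        simp only [hk]; linarith)
    (by
      rw [sum_erase _ (by simp [hkw])]
      simp only [hk, sub_smul, sum_sub_distrib, mul_smul, ← smul_sum, hg0, smul_zero, sub_zero, hx])
  exact ⟨s, hs.trans (erase_subset _ _), h⟩

/-- A simultaneous Diophantine approximation: integer multiples of a real vector come arbitrarily
close to the integer lattice, with exact approximation of the vanishing coordinates. -/
theorem exists_pos_nat_simultaneous_approx {ι : Type*} [Fintype ι] (a : ι → ℝ) {δ : ℝ}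
    (hδ : 0 < δ) :
    ∃ R : ℕ, 0 < R ∧ ∃ q : ι → ℤ, (∀ i, |q i - R * a i| < δ) ∧ ∀ i, a i = 0 → q i = 0 := by
  obtain ⟨b, -, φ, hφ, hlim⟩ := (isCompact_Icc (a := (0 : ι → ℝ)) (b := 1)).tendsto_subseq
    (x := fun k : ℕ => fun i => Int.fract (k * a i))
    (fun k => ⟨fun i => Int.fract_nonneg _, fun i => (Int.fract_lt_one _).le⟩)
  obtain ⟨N, hN⟩ := Metric.cauchySeq_iff'.1 hlim.cauchySeq δ hδ
  have hlt : φ N < φ (N + 1) := hφ N.lt_succ_self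
  refine ⟨φ (N + 1) - φ N, by omega, fun i => ⌊φ (N + 1) * a i⌋ - ⌊φ N * a i⌋, fun i => ?_,
    fun i hi => by simp [hi]⟩
  have h := (dist_le_pi_dist _ _ i).trans_lt (hN (N + 1) (by omega))
  rw [Real.dist_eq, abs_sub_comm] at h
  simp only [Function.comp, Int.fract] at h
  push_cast [Nat.cast_sub hlt.le]
  rwa [show ((⌊φ (N + 1) * a i⌋ : ℝ) - ⌊φ N * a i⌋ - (φ (N + 1) - φ N) * a i) =
    φ N * a i - ⌊φ N * a i⌋ - (φ (N + 1) * a i - ⌊φ (N + 1) * a i⌋) by ring]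

/-- Every point `a` of the simplex admits an integer vector divisible by `m`, of positive sum `R`
bounded independently of `a`, which is at most `(R + 1/2) a` in each coordinate. -/
theorem exists_bound_integer_multiple_le {ι : Type*} [Fintype ι] {m : ℕ} (hm : 0 < m) :
    ∃ B : ℕ, ∀ a ∈ stdSimplex ℝ ι, ∃ R : ℕ, 0 < R ∧ R ≤ B ∧ ∃ q : ι → ℤ,
      ∑ i, q i = R ∧ (∀ i, (m : ℤ) ∣ q i) ∧ ∀ i, (q i : ℝ) ≤ (R + 1 / 2) * a i := by
  refine (isCompact_stdSimplex ℝ ι).induction_on (p := fun s => ∃ B : ℕ, ∀ a ∈ s, ∃ R : ℕ, 0 < R ∧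
    R ≤ B ∧ ∃ q : ι → ℤ, ∑ i, q i = R ∧ (∀ i, (m : ℤ) ∣ q i) ∧
      ∀ i, (q i : ℝ) ≤ (R + 1 / 2) * a i) ⟨0, by simp⟩ ?_ ?_ ?_
  · rintro s t hst ⟨B, hB⟩
    exact ⟨B, fun a ha => hB a (hst ha)⟩
  · rintro s t ⟨B, hB⟩ ⟨B', hB'⟩
    refine ⟨max B B', ?_⟩
    rintro a (ha | ha)
    · obtain ⟨R, h0, h1, h⟩ := hB a ha
      exact ⟨R, h0, h1.trans (le_max_left _ _), h⟩
    · obtain ⟨R, h0, h1, h⟩ := hB' a ha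
      exact ⟨R, h0, h1.trans (le_max_right _ _), h⟩
  intro a ha
  have hm' : (0 : ℝ) < m := by exact_mod_cast hm
  obtain ⟨ε, hε, hεa⟩ : ∃ ε : ℝ, 0 < ε ∧ ∀ i, a i ≠ 0 → ε ≤ a i := by
    have : ∀ᶠ ε in nhdsWithin (0 : ℝ) (Set.Ioi 0), ∀ i, a i ≠ 0 → ε ≤ a i := by
      rw [Filter.eventually_all]
      intro i
      by_cases hi : a i = 0
      · simp [hi]
      · filter_upwards [Ioc_mem_nhdsGT ((ha.1 i).lt_of_ne' hi)] with ε hε _ using hε.2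
    obtain ⟨ε, h1, h2⟩ := (this.and self_mem_nhdsWithin).exists
    exact ⟨ε, h2, h1⟩
  set d : ℝ := (Fintype.card ι : ℝ) with hd
  have hd0 : 0 ≤ d := Nat.cast_nonneg _
  obtain ⟨R, hR, q, hq, hq0⟩ := exists_pos_nat_simultaneous_approx a
    (δ := min (ε / (4 * m)) (1 / (d + 1))) (by positivity)
  have hsum : ∑ i, q i = R := by
    have h1 : |((∑ i, q i - R : ℤ) : ℝ)| < 1 := by
      have : ((∑ i, q i - R : ℤ) : ℝ) = ∑ i, (q i - R * a i) := by
        push_cast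
        rw [sum_sub_distrib, ← mul_sum, ha.2, mul_one]
      rw [this]
      calc |∑ i, (q i - R * a i)| ≤ ∑ i, |q i - R * a i| := abs_sum_le_sum_abs _ _
        _ ≤ ∑ _i : ι, 1 / (d + 1) := sum_le_sum fun i _ => ((hq i).trans_le (min_le_right _ _)).le
        _ = d / (d + 1) := by simp [hd, div_eq_mul_inv]
        _ < 1 := by rw [div_lt_one (by positivity)]; linarith
    have h2 : |(∑ i, q i - R : ℤ)| < 1 := by exact_mod_cast h1
    have := Int.abs_lt_one_iff.1 h2
    omega
  refine ⟨{b | ∀ i, (m * q i : ℝ) ≤ (m * R + 1 / 2) * b i}, ?_, m * R, fun b hb => ?_⟩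
  · refine Filter.eventually_all.2 fun i => ?_
    by_cases hi : a i = 0
    · filter_upwards [self_mem_nhdsWithin] with b hb
      have := hb.1 i
      rw [hq0 i hi, Int.cast_zero, mul_zero]
      positivity
    · have hai : (m * q i : ℝ) < (m * R + 1 / 2) * a i := by
        have h1 := (abs_lt.1 ((hq i).trans_le (min_le_left _ _))).2
        have h2 : m * (q i - R * a i) < m * (ε / (4 * m)) := by gcongr
        have h3 : (m : ℝ) * (ε / (4 * m)) = ε / 4 := by field_simp
        have := hεa i hi
        linarith
      have hc : Filter.Tendsto (fun b : ι → ℝ => (m * R + 1 / 2) * b i)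
          (nhdsWithin a (stdSimplex ℝ ι)) (nhds ((m * R + 1 / 2) * a i)) :=
        (Continuous.tendsto (by fun_prop) a).mono_left nhdsWithin_le_nhds
      filter_upwards [hc.eventually_const_lt hai] with b hb using hb.le
  · refine ⟨m * R, by positivity, le_rfl, fun i => m * q i, ?_, fun i => dvd_mul_right _ _, ?_⟩
    · rw [← mul_sum, hsum]
      push_cast
      rfl
    · intro i
      push_cast
      exact hb i

/-- A convex set containing `0` is closed under nonnegative combinations of total weight at
most `1`. -/
theorem Convex.sum_smul_mem_of_sum_le_one {E ι : Type*} [AddCommGroup E] [Module ℝ E] {s : Set E}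
    (hs : Convex ℝ s) (h0 : 0 ∈ s) {t : Finset ι} {w : ι → ℝ} {z : ι → E}
    (hw : ∀ i ∈ t, 0 ≤ w i) (hw1 : ∑ i ∈ t, w i ≤ 1) (hz : ∀ i ∈ t, z i ∈ s) :
    ∑ i ∈ t, w i • z i ∈ s := by
  rcases (sum_nonneg hw).eq_or_lt with h | h
  · rw [sum_eq_zero fun i hi => by rw [(sum_eq_zero_iff_of_nonneg hw).1 h.symm i hi, zero_smul]]
    exact h0
  · have := hs.smul_mem_of_zero_mem h0 (hs.centerMass_mem hw h hz) ⟨h.le, hw1⟩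
    rwa [centerMass, smul_smul, mul_inv_cancel₀ h.ne', one_smul] at this

/-- A convex set containing `0` in its interior contains in its interior every nonnegative
combination of its points of total weight less than `1`. -/
theorem Convex.sum_smul_mem_interior_of_sum_lt_one {E ι : Type*} [NormedAddCommGroup E]
    [NormedSpace ℝ E] {s : Set E} (hs : Convex ℝ s) (h0 : 0 ∈ interior s) {t : Finset ι}
    {w : ι → ℝ} {z : ι → E} (hw : ∀ i ∈ t, 0 ≤ w i) (hw1 : ∑ i ∈ t, w i < 1)
    (hz : ∀ i ∈ t, z i ∈ s) : ∑ i ∈ t, w i • z i ∈ interior s := by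
  have hS := sum_nonneg hw
  set r := (1 + ∑ i ∈ t, w i) / 2 with hr
  have hr0 : 0 < r := by linarith
  have h := hs.sum_smul_mem_of_sum_le_one (interior_subset h0) (w := fun i => r⁻¹ * w i)
    (fun i hi => mul_nonneg (inv_nonneg.2 hr0.le) (hw i hi))
    (by rw [← mul_sum, inv_mul_le_iff₀ hr0]; linarith) hz
  have := hs.combo_interior_self_mem_interior h0 h (a := 1 - r) (b := r) (by linarith) hr0.le
    (by ring)
  rw [smul_zero, zero_add, smul_sum] at this
  simpa only [smul_smul, mul_inv_cancel_left₀ hr0.ne'] using this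

/-- If `0` lies in the interior of the convex hull of `V`, then every vector is a nonnegative
combination of linearly independent elements of `V`. -/
theorem exists_linearIndependent_nonneg_sum_eq {E : Type*} [NormedAddCommGroup E]
    [NormedSpace ℝ E] [FiniteDimensional ℝ E] (V : Finset E)
    (h0 : 0 ∈ interior (convexHull ℝ (V : Set E))) (x : E) :
    ∃ d ≤ Module.finrank ℝ E, ∃ (w : Fin d → E) (g : Fin d → ℝ), (∀ j, w j ∈ V) ∧
      (∀ j, 0 ≤ g j) ∧ ∑ j, g j • w j = x ∧ LinearIndependent ℝ w := by
  have habs := absorbent_nhds_zero (𝕜 := ℝ) (mem_interior_iff_mem_nhds.1 h0)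
  obtain ⟨r, hr, hx⟩ := (habs.gauge_set_nonempty (x := x))
  obtain ⟨y, hy, rfl⟩ := hx
  rw [Finset.convexHull_eq] at hy
  obtain ⟨f, hf0, hf1, rfl⟩ := hy
  rw [centerMass_eq_of_sum_1 _ _ hf1]
  obtain ⟨s, hs, g, hg0, hg, hind⟩ := exists_subset_linearIndepOn_nonneg_sum V
    (r • ∑ v ∈ V, f v • v) (fun v => r * f v) (fun v hv => mul_nonneg hr.le (hf0 v hv))
    (by simp only [mul_smul, smul_sum])
  let e := s.equivFin
  have hind' : LinearIndependent ℝ (fun j => (e.symm j : E)) := by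
    have h : LinearIndependent ℝ (fun v : s => (v : E)) := hind
    exact h.comp _ e.symm.injective
  refine ⟨s.card, by simpa using hind'.fintype_card_le_finrank, fun j => e.symm j,
    fun j => g (e.symm j), fun j => hs (e.symm j).2, fun j => hg0 _ (e.symm j).2, ?_, hind'⟩
  rw [e.symm.sum_comp (fun v : s => g v • (v : E)), sum_coe_sort s (fun v => g v • v), hg]
  rfl

/-- The asymmetry about `0` of a lattice polytope with `0` as its only interior point
in `mℤⁿ` is bounded in terms of `n` and `m`. -/
theorem exists_bound_asymmetry (n : ℕ) {m : ℕ} (hm : 0 < m) :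
    ∃ Λ : ℝ, 0 < Λ ∧ ∀ V : Finset (Fin n → ℝ), (∀ v ∈ V, IsLatticePoint v) →
      0 ∈ interior (convexHull ℝ (V : Set (Fin n → ℝ))) →
      (∀ z, IsLatticePoint z → (m : ℝ) • z ∈ interior (convexHull ℝ (V : Set (Fin n → ℝ))) →
        z = 0) →
      ∀ x ∈ convexHull ℝ (V : Set (Fin n → ℝ)),
        Λ⁻¹ • (-x) ∈ convexHull ℝ (V : Set (Fin n → ℝ)) := by
  choose B hB using fun d : ℕ => exists_bound_integer_multiple_le (ι := Fin d) hm
  set b : ℕ := ∑ d ∈ range (n + 1), B d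
  refine ⟨2 * b + 1, by positivity, fun V hV h0 hlat => ?_⟩
  set P := convexHull ℝ (V : Set (Fin n → ℝ))
  have hPc : Convex ℝ P := convex_convexHull ℝ _
  have hneg : P ⊆ (LinearMap.lsmul ℝ (Fin n → ℝ) (-(2 * b + 1 : ℝ)⁻¹)) ⁻¹' P := by
    refine convexHull_min (fun v hv => ?_) (hPc.linear_preimage _)
    obtain ⟨d, hd, w, g, hwV, hg0, hg, hind⟩ :=
      exists_linearIndependent_nonneg_sum_eq V h0 (-v)
    have hwP : ∀ j, w j ∈ P := fun j => subset_convexHull ℝ _ (hwV j)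
    have hvP : v ∈ P := subset_convexHull ℝ _ hv
    suffices hG : ∑ j, g j ≤ 2 * b + 1 by
      have := hPc.sum_smul_mem_of_sum_le_one (interior_subset h0) (t := univ)
        (w := fun j => (2 * b + 1 : ℝ)⁻¹ * g j) (z := w) (fun j _ => by have := hg0 j; positivity)
        (by rw [← mul_sum, inv_mul_le_iff₀ (by positivity)]; linarith) (fun j _ => hwP j)
      simpa only [mul_smul, ← smul_sum, hg, Set.mem_preimage, LinearMap.lsmul_apply, smul_neg,
        neg_smul] using this
    by_contra! hG
    set G := ∑ j, g j with hGdef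
    have hG0 : 0 < G := lt_trans (by positivity) hG
    obtain ⟨R, hR0, hRB, q, hqR, hqm, hq⟩ := hB d (fun j => g j / G)
      ⟨fun j => div_nonneg (hg0 j) hG0.le, by rw [← sum_div, div_self hG0.ne']⟩
    have hRb : (R : ℝ) ≤ b := by
      have : B d ≤ b := single_le_sum (f := B) (fun _ _ => Nat.zero_le _)
        (by simp at hd; simp; omega)
      exact_mod_cast hRB.trans this
    choose r hr using hqm
    have hm' : (m : ℝ) ≠ 0 := by positivity
    have hcomb : (m : ℝ) • (-∑ j, (r j : ℝ) • w j) = -∑ j, (q j : ℝ) • w j := by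
      simp only [hr, smul_neg, smul_sum, smul_smul, Int.cast_mul, Int.cast_natCast]
    have hz := hlat (-∑ j, (r j : ℝ) • w j) ?_ ?_
    · have hq0 : ∑ j, (q j : ℝ) • w j = 0 := by
        rw [hz, smul_zero] at hcomb
        exact neg_eq_zero.1 hcomb.symm
      have := Fintype.linearIndependent_iff.1 hind _ hq0
      have hq' : ∀ j, q j = 0 := fun j => by exact_mod_cast this j
      simp only [hq', sum_const_zero] at hqR
      omega
    · choose c hc using fun j => hV _ (hwV j)
      refine fun i => ⟨-∑ j, r j * c j i, ?_⟩
      simp [hc]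
    · rw [hcomb]
      have h := hPc.sum_smul_mem_interior_of_sum_lt_one h0 (t := univ)
        (w := fun o : Option (Fin d) => o.elim ((R + 1 / 2) / G)
          fun j => (R + 1 / 2) * (g j / G) - q j)
        (z := fun o => o.elim v w) ?_ ?_ ?_
      · convert h using 1
        simp only [Fintype.sum_option, Option.elim, sub_smul, sum_sub_distrib]
        have : ∑ j, ((R + 1 / 2) * (g j / G)) • w j = -(((R + 1 / 2) / G) • v) := by
          rw [← smul_neg, ← hg, smul_sum]
          refine sum_congr rfl fun j _ => ?_
          rw [smul_smul]
          congr 1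
          ring
        rw [this]
        abel
      · rintro (_ | j) -
        · simp only [Option.elim]; positivity
        · simpa using hq j
      · simp only [Fintype.sum_option, Option.elim, sum_sub_distrib, ← mul_sum, ← sum_div, ← hGdef,
          div_self hG0.ne']
        have h1 : ∑ j, (q j : ℝ) = R := by exact_mod_cast hqR
        have h2 : (R + 1 / 2) / G < 1 / 2 := by
          rw [div_lt_iff₀ hG0]; linarith
        linarith
      · rintro (_ | j) - <;> simp [hvP, hwP]
  intro x hx
  have := hneg hx
  simpa using this

/-- Every boundary point of a polytope with `0` in its interior lies on a face cut out by a
functional equal to `1` on it that spans the whole space. -/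
theorem exists_supporting_span_eq_top {E : Type*} [NormedAddCommGroup E] [NormedSpace ℝ E]
    (V : Finset E) (h0 : 0 ∈ interior (convexHull ℝ (V : Set E)))
    {y : E} (hy : y ∈ convexHull ℝ (V : Set E)) (hy' : y ∉ interior (convexHull ℝ (V : Set E))) :
    ∃ f : E →ₗ[ℝ] ℝ, (∀ x ∈ convexHull ℝ (V : Set E), f x ≤ 1) ∧ f y = 1 ∧
      Submodule.span ℝ {x ∈ convexHull ℝ (V : Set E) | f x = 1} = ⊤ := by
  classical
  set P := convexHull ℝ (V : Set E)
  have hPc : Convex ℝ P := convex_convexHull ℝ _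
  have hVP : ∀ v ∈ V, v ∈ P := fun v hv => subset_convexHull ℝ _ hv
  have hle : ∀ (f : E →ₗ[ℝ] ℝ) (c : ℝ), (∀ v ∈ V, f v ≤ c) → ∀ x ∈ P, f x ≤ c := fun f c hf =>
    convexHull_min hf (convex_halfSpace_le f.isLinear c)
  have hex : ∃ f : E →ₗ[ℝ] ℝ, (∀ v ∈ V, f v ≤ 1) ∧ f y = 1 := by
    obtain ⟨f, hf⟩ := geometric_hahn_banach_open_point hPc.interior isOpen_interior hy'
    have hfy : 0 < f y := by simpa using hf 0 h0
    have hcl : closure (interior P) ⊆ {x | f x ≤ f y} :=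
      closure_minimal (fun a ha => (hf a ha).le) (isClosed_le f.continuous continuous_const)
    rw [hPc.closure_interior_eq_closure_of_nonempty_interior ⟨0, h0⟩] at hcl
    refine ⟨(f y)⁻¹ • (f : E →ₗ[ℝ] ℝ), fun v hv => ?_, by simp [hfy.ne']⟩
    have : f v ≤ f y := hcl (subset_closure (hVP v hv))
    simpa [inv_mul_le_iff₀ hfy] using this
  obtain ⟨T, hT, hmax⟩ := ({T ∈ V.powerset | ∃ f : E →ₗ[ℝ] ℝ, (∀ v ∈ V, f v ≤ 1) ∧ f y = 1 ∧
      {v ∈ V | f v = 1} = T}).exists_max_image Finset.card (by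
    obtain ⟨f, hf, hfy⟩ := hex
    exact ⟨{v ∈ V | f v = 1}, mem_filter.2 ⟨mem_powerset.2 (filter_subset _ _), f, hf, hfy, rfl⟩⟩)
  simp only [mem_filter, mem_powerset] at hT hmax
  obtain ⟨-, f, hf, hfy, rfl⟩ := hT
  refine ⟨f, hle f 1 hf, hfy, ?_⟩
  by_contra hne
  obtain ⟨w, hw0, hw⟩ := Submodule.exists_le_ker_of_lt_top _ (lt_top_iff_ne_top.2 hne)
  have hwF : ∀ x ∈ P, f x = 1 → w x = 0 := fun x hx hfx =>
    hw (Submodule.subset_span ⟨hx, hfx⟩)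
  obtain ⟨v₀, hv₀, hwv₀⟩ : ∃ v ∈ V, 0 < w v := by
    by_contra! hcon
    refine hw0 (LinearMap.ext fun x => ?_)
    have habs := absorbent_nhds_zero (𝕜 := ℝ) (mem_interior_iff_mem_nhds.1 h0)
    have hnonpos : ∀ x, w x ≤ 0 := by
      intro x
      obtain ⟨r, hr, p, hp, rfl⟩ := habs.gauge_set_nonempty (x := x)
      simpa using mul_nonpos_of_nonneg_of_nonpos (le_of_lt hr) (hle w 0 hcon p hp)
    exact le_antisymm (hnonpos x) (by simpa using hnonpos (-x))
  obtain ⟨v₁, hv₁, hmin⟩ := ({v ∈ V | 0 < w v}).exists_min_image (fun v => (1 - f v) / w v)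
    ⟨v₀, by simp [hv₀, hwv₀]⟩
  obtain ⟨hv₁V, hwv₁⟩ := mem_filter.1 hv₁
  set t := (1 - f v₁) / w v₁ with ht
  have ht0 : 0 ≤ t := div_nonneg (by linarith [hf v₁ hv₁V]) hwv₁.le
  have hnew : ∀ v ∈ V, (f + t • w) v ≤ 1 := by
    intro v hv
    simp only [LinearMap.add_apply, LinearMap.smul_apply, smul_eq_mul]
    rcases lt_or_ge 0 (w v) with h | h
    · have := hmin v (by simp [hv, h])
      rw [le_div_iff₀ h] at this
      linarith
    · linarith [mul_nonpos_of_nonneg_of_nonpos ht0 h, hf v hv]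
  have hcard := hmax {v ∈ V | (f + t • w) v = 1} ⟨filter_subset _ _, f + t • w, hnew,
    by simp [hfy, hwF y hy hfy], rfl⟩
  refine hcard.not_gt (card_lt_card (ssubset_iff_of_subset ?_ |>.2 ⟨v₁, ?_, ?_⟩))
  · intro v hv
    rw [mem_filter] at hv ⊢
    exact ⟨hv.1, by simp [hv.2, hwF v (hVP v hv.1) hv.2]⟩
  · rw [mem_filter]
    exact ⟨hv₁V, by simp [ht, hwv₁.ne']⟩
  · intro h
    exact hwv₁.ne' (hwF v₁ (hVP v₁ hv₁V) (mem_filter.1 h).2)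

/-- A set on which a linear functional is constantly `1` and which spans the whole space spans
an affine hyperplane. -/
theorem finrank_vectorSpan_add_one_of_span_eq_top {E : Type*} [AddCommGroup E] [Module ℝ E]
    [FiniteDimensional ℝ E] {F : Set E} {f : E →ₗ[ℝ] ℝ} (hf : ∀ x ∈ F, f x = 1) {y : E}
    (hy : y ∈ F) (hF : Submodule.span ℝ F = ⊤) :
    Module.finrank ℝ (vectorSpan ℝ F) + 1 = Module.finrank ℝ E := by
  have hker : vectorSpan ℝ F = LinearMap.ker f := by
    refine le_antisymm ?_ fun x hx => ?_
    · rw [vectorSpan_def, Submodule.span_le]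
      rintro _ ⟨a, ha, b, hb, rfl⟩
      simp [hf a ha, hf b hb]
    · have hmem : ∀ x, x - f x • y ∈ vectorSpan ℝ F := by
        intro x
        have hx : x ∈ Submodule.span ℝ F := hF ▸ Submodule.mem_top
        induction hx using Submodule.span_induction with
        | mem x hx => simpa [hf x hx] using vsub_mem_vectorSpan ℝ hx hy
        | zero => simp
        | add a b _ _ ha hb =>
          convert add_mem ha hb using 1
          rw [map_add, add_smul]; abel
        | smul c a _ ha =>
          convert Submodule.smul_mem _ c ha using 1
          rw [map_smul, smul_sub, smul_assoc]
      simpa [LinearMap.mem_ker.1 hx] using hmem x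
  have hrange : LinearMap.range f = ⊤ :=
    LinearMap.range_eq_top.2 (LinearMap.surjective fun h => by simpa [h] using hf y hy)
  have := f.finrank_range_add_finrank_ker
  rw [hrange, finrank_top, Module.finrank_self] at this
  rw [hker]
  omega

/-- A lattice polytope with `0` in its interior and facets at integral distance at most `m` from
`0` has no nonzero interior point in `mℤⁿ`. -/
theorem eq_zero_of_smul_mem_interior {n m : ℕ} (hm : 0 < m) (V : Finset (Fin n → ℝ))
    (h0 : 0 ∈ interior (convexHull ℝ (V : Set (Fin n → ℝ))))
    (hfacet : ∀ F : Set (Fin n → ℝ), IsFaceOf F (convexHull ℝ (V : Set (Fin n → ℝ))) →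
      faceDim F + 1 = n → ∃ l : Fin n → ℤ, ∃ c : ℤ, Finset.univ.gcd l = 1 ∧ |c| ≤ (m : ℤ) ∧
        F ⊆ {x | dotp x (fun i => (l i : ℝ)) = (c : ℝ)})
    {z : Fin n → ℝ} (hz : IsLatticePoint z)
    (hmz : (m : ℝ) • z ∈ interior (convexHull ℝ (V : Set (Fin n → ℝ)))) : z = 0 := by
  by_contra hz0
  set P := convexHull ℝ (V : Set (Fin n → ℝ))
  have hPc : Convex ℝ P := convex_convexHull ℝ _
  have hPcomp : IsCompact P := V.finite_toSet.isCompact_convexHull ℝ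
  have hnhds := mem_interior_iff_mem_nhds.1 h0
  have hm0 : (0 : ℝ) < m := by exact_mod_cast hm
  set t := gauge P ((m : ℝ) • z) with ht
  have ht1 : t < 1 := (gauge_lt_one_iff_mem_interior hPc hnhds).2 hmz
  have ht0 : 0 < t := (gauge_pos (absorbent_nhds_zero hnhds)
    ((NormedSpace.isVonNBounded_iff ℝ).2 hPcomp.isBounded)).2 (smul_ne_zero hm0.ne' hz0)
  set y := t⁻¹ • (m : ℝ) • z with hy
  have hyfr : y ∈ frontier P := by
    rw [← gauge_eq_one_iff_mem_frontier hPc hnhds, hy, gauge_smul_of_nonneg (by positivity),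
      smul_eq_mul, ← ht, inv_mul_cancel₀ ht0.ne']
  have hyP : y ∈ P := hPcomp.isClosed.closure_eq ▸ hyfr.1
  obtain ⟨f, hf1, hfy, hspan⟩ := exists_supporting_span_eq_top V h0 hyP hyfr.2
  have hfu : ∀ x, dotp x (fun i => f (Pi.single i 1)) = f x := fun x => by
    rw [LinearMap.pi_apply_eq_sum_univ f x]
    simp only [dotp, smul_eq_mul]
    refine sum_congr rfl fun i _ => ?_
    congr 2
    ext j
    simp [Pi.single_apply, eq_comm]
  have hdim := finrank_vectorSpan_add_one_of_span_eq_top (F := {x ∈ P | f x = 1})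
    (fun x hx => hx.2) ⟨hyP, hfy⟩ hspan
  obtain ⟨l, c, hl, hcm, hF⟩ := hfacet {x ∈ P | f x = 1}
    ⟨⟨y, hyP, hfy⟩, fun i => f (Pi.single i 1), 1, fun x hx => (hfu x).trans_le (hf1 x hx), by
      simp only [hfu]⟩
    (hdim.trans (Module.finrank_fin_fun ℝ))
  let g : (Fin n → ℝ) →ₗ[ℝ] ℝ := ∑ i, (l i : ℝ) • LinearMap.proj i
  have hg : ∀ x, dotp x (fun i => (l i : ℝ)) = g x := fun x => by
    simp [dotp, g, mul_comm]
  simp only [hg] at hF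
  have hc0 : c ≠ 0 := by
    rintro rfl
    have hker : Submodule.span ℝ {x ∈ P | f x = 1} ≤ LinearMap.ker g :=
      Submodule.span_le.2 fun x hx => by simpa using hF hx
    rw [hspan] at hker
    have hl0 : ∀ i, l i = 0 := fun i => by
      have h : g (Pi.single i 1) = 0 := hker Submodule.mem_top
      simpa [← hg, dotp, Pi.single_apply] using h
    rw [Finset.gcd_eq_zero_iff.2 fun i _ => hl0 i] at hl
    exact zero_ne_one hl
  choose k hk using hz
  have hgz : g z = ((∑ i, k i * l i : ℤ) : ℝ) := by
    simp [← hg, dotp, hk]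
  have hgy : g y = c := hF ⟨hyP, hfy⟩
  have hmul : (m : ℝ) * (∑ i, k i * l i : ℤ) = t * c := by
    rw [← hgz, ← hgy, hy, map_smul, map_smul, smul_eq_mul, smul_eq_mul,
      mul_inv_cancel_left₀ ht0.ne']
  set N : ℤ := ∑ i, k i * l i
  have hN0 : N ≠ 0 := fun h => by
    rw [h, Int.cast_zero, mul_zero] at hmul
    exact mul_ne_zero ht0.ne' (Int.cast_ne_zero.2 hc0) hmul.symm
  have h1 : (1 : ℝ) ≤ |(N : ℝ)| := by exact_mod_cast Int.one_le_abs hN0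
  have h2 : |(c : ℝ)| ≤ m := by exact_mod_cast hcm
  have h3 : (0 : ℝ) < |(c : ℝ)| := abs_pos.2 (Int.cast_ne_zero.2 hc0)
  have h4 : (m : ℝ) * |(N : ℝ)| = t * |(c : ℝ)| := by
    rw [← abs_of_pos hm0, ← abs_mul, hmul, abs_mul, abs_of_pos ht0]
  nlinarith

/-- Minkowski's convex body theorem for the lattice `ℤⁿ`. -/
theorem exists_ne_zero_isLatticePoint_mem {n : ℕ} {s : Set (Fin n → ℝ)}
    (hsymm : ∀ x ∈ s, -x ∈ s) (hconv : Convex ℝ s) (hvol : 2 ^ n < MeasureTheory.volume s) :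
    ∃ z ∈ s, z ≠ 0 ∧ IsLatticePoint z := by
  have hfund := ZSpan.isAddFundamentalDomain' (Pi.basisFun ℝ (Fin n)) MeasureTheory.volume
  have : Countable (Submodule.span ℤ (Set.range (Pi.basisFun ℝ (Fin n)))).toAddSubgroup :=
    inferInstanceAs (Countable (Submodule.span ℤ (Set.range (Pi.basisFun ℝ (Fin n)))))
  obtain ⟨z, hz0, hzs⟩ :=
    MeasureTheory.exists_ne_zero_mem_lattice_of_measure_mul_two_pow_lt_measure hfund hsymm hconv (by
      simpa [ZSpan.fundamentalDomain_pi_basisFun, MeasureTheory.volume_pi_pi] using hvol)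
  refine ⟨z, hzs, by simpa using hz0, fun i => ?_⟩
  have hz : (z : Fin n → ℝ) ∈ Submodule.span ℤ (Set.range (Pi.basisFun ℝ (Fin n))) := z.2
  obtain ⟨k, hk⟩ := (Module.Basis.mem_span_iff_repr_mem ℤ (Pi.basisFun ℝ (Fin n)) _).1 hz i
  exact ⟨k, by simpa using hk.symm⟩

/-- For all positive integers `n, m` there is a constant `C(n, m)` bounding
the volume of every `n`-dimensional lattice polytope `P ⊂ ℝⁿ` that contains `0` in its
interior and all of whose facets lie on hyperplanes `{x | ⟨x, l⟩ = c}` with `l ∈ ℤⁿ`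
primitive and `|c| ≤ m`. -/
theorem volume_bound_of_facets_at_bounded_integral_distance (n m : ℕ)
    (hn : 0 < n) (hm : 0 < m) :
    ∃ C : ℝ, ∀ P : Set (Fin n → ℝ),
      IsLatticePolytope P →
      (0 : Fin n → ℝ) ∈ interior P →
      (∀ F : Set (Fin n → ℝ), IsFaceOf F P → faceDim F + 1 = n →
        ∃ l : Fin n → ℤ, ∃ c : ℤ, Finset.univ.gcd l = 1 ∧ |c| ≤ (m : ℤ) ∧
          F ⊆ {x | dotp x (fun i => (l i : ℝ)) = (c : ℝ)}) →
      (MeasureTheory.volume P).toReal ≤ C := by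
  obtain ⟨Λ, hΛ, hasym⟩ := exists_bound_asymmetry n hm
  have hm0 : (0 : ℝ) < m := by exact_mod_cast hm
  set t : ℝ := (m * (Λ + 1))⁻¹ with ht
  have ht0 : 0 < t := by positivity
  refine ⟨2 ^ n / t ^ n, fun P hP h0 hfacet => ?_⟩
  obtain ⟨V, hVfin, hV, rfl⟩ := hP
  lift V to Finset (Fin n → ℝ) using hVfin
  have hlat := fun z => eq_zero_of_smul_mem_interior (z := z) hm V h0 hfacet
  have hneg := hasym V hV h0 fun z => hlat z
  set P := convexHull ℝ (V : Set (Fin n → ℝ))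
  have hPc : Convex ℝ P := convex_convexHull ℝ _
  by_contra! hvol
  have hshrink : ∀ x ∈ P, ∀ r : ℝ, 0 ≤ r → r < 1 → r • x ∈ interior P := fun x hx r hr0 hr1 => by
    simpa using hPc.sum_smul_mem_interior_of_sum_lt_one h0 (t := ({()} : Finset Unit))
      (w := fun _ => r) (z := fun _ => x) (by simpa) (by simpa) (by simpa)
  let s : Set (Fin n → ℝ) := {x | (m : ℝ) • x ∈ interior P ∧ -((m : ℝ) • x) ∈ interior P}
  have hts : (fun x => t • x) '' P ⊆ s := by
    rintro _ ⟨x, hx, rfl⟩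
    have hmt : (m : ℝ) * t = (Λ + 1)⁻¹ := by rw [ht]; field_simp
    constructor
    · simp only [smul_smul, hmt]
      exact hshrink x hx _ (by positivity) (inv_lt_one_of_one_lt₀ (by linarith))
    · have := hshrink _ (hneg x hx) (Λ * (Λ + 1)⁻¹) (by positivity)
        (by rw [← div_eq_mul_inv, div_lt_one (by positivity)]; linarith)
      rw [smul_smul, mul_right_comm, mul_inv_cancel₀ hΛ.ne', one_mul, smul_neg] at this
      simpa only [smul_smul, hmt] using this
  have hsconv : Convex ℝ s := by
    have h1 := hPc.interior.linear_preimage (LinearMap.lsmul ℝ (Fin n → ℝ) (m : ℝ))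
    have h2 := hPc.interior.linear_preimage (LinearMap.lsmul ℝ (Fin n → ℝ) (-m : ℝ))
    have hs : s = LinearMap.lsmul ℝ (Fin n → ℝ) (m : ℝ) ⁻¹' interior P ∩
        LinearMap.lsmul ℝ (Fin n → ℝ) (-m : ℝ) ⁻¹' interior P := by
      ext x
      simp [s]
    exact hs ▸ h1.inter h2
  obtain ⟨z, hz, hz0, hzl⟩ := exists_ne_zero_isLatticePoint_mem (s := s)
    (fun x hx => ⟨by simpa using hx.2, by simpa using hx.1⟩) hsconv (by
      refine lt_of_lt_of_le ?_ (MeasureTheory.measure_mono hts)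
      have hfin : MeasureTheory.volume P ≠ ⊤ :=
        (V.finite_toSet.isCompact_convexHull ℝ).measure_ne_top
      have hscale : MeasureTheory.volume ((fun x => t • x) '' P) = _ :=
        MeasureTheory.Measure.addHaar_smul MeasureTheory.volume t P
      rw [hscale, Module.finrank_fin_fun, abs_of_pos (pow_pos ht0 n),
        ← ENNReal.ofReal_toReal hfin, ← ENNReal.ofReal_mul (by positivity)]
      rw [div_lt_iff₀ (by positivity), mul_comm] at hvol
      have h2 : (2 : ENNReal) ^ n = ENNReal.ofReal (2 ^ n) := by
        rw [ENNReal.ofReal_pow (by norm_num), ENNReal.ofReal_ofNat]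
      rw [h2]
      exact (ENNReal.ofReal_lt_ofReal_iff_of_nonneg (by positivity)).2 hvol)
  exact hz0 (hlat z hzl hz.1)
end

section
/- For every positive integer n, there exist up to isomorphism only finitely many n-dimensional reflexive polytopes: there is a finite list Δ₁, …, Δ_k of reflexive polytopes in ℝⁿ such that every reflexive polytope Δ ⊂ ℝⁿ satisfies Δ = A(Δ_i) for some index i and some A ∈ GLₙ(ℤ). -/
open Finset

theorem exists_simultaneous_approx {k N : ℕ} (hN : 0 < N) (β : Fin k → ℝ) :
    ∃ m : ℕ, 0 < m ∧ m ≤ N ^ k ∧ ∃ p : Fin k → ℤ, ∀ i, |m * β i - p i| < 1 / N := by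
  have hN' : (0 : ℝ) < N := by exact_mod_cast hN
  have hlt (j : ℕ) (i : Fin k) : ⌊N * Int.fract (j * β i)⌋₊ < N := by
    rw [Nat.floor_lt (by positivity)]
    nlinarith [Int.fract_lt_one (j * β i)]
  obtain ⟨a, b, hab, hf⟩ := Fintype.exists_ne_map_eq_of_card_lt
    (fun (j : Fin (N ^ k + 1)) (i : Fin k) => (⟨_, hlt j i⟩ : Fin N)) (by simp)
  wlog h : a < b generalizing a b
  · exact this b a hab.symm hf.symm (lt_of_le_of_ne (not_lt.1 h) hab.symm)
  have h' : (a : ℕ) < b := h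
  refine ⟨b - a, by omega, by omega, fun i => ⌊(b : ℕ) * β i⌋ - ⌊(a : ℕ) * β i⌋, fun i => ?_⟩
  have hi : ⌊N * Int.fract (((a : ℕ) : ℝ) * β i)⌋₊ = ⌊N * Int.fract (((b : ℕ) : ℝ) * β i)⌋₊ := by
    simpa using congrFun hf i
  have key : |(N * Int.fract (((b : ℕ) : ℝ) * β i)) - N * Int.fract (((a : ℕ) : ℝ) * β i)| < 1 := by
    have a1 := Nat.floor_le (show 0 ≤ N * Int.fract (((a : ℕ) : ℝ) * β i) by positivity)
    have a2 := Nat.lt_floor_add_one (N * Int.fract (((a : ℕ) : ℝ) * β i))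
    have b1 := Nat.floor_le (show 0 ≤ N * Int.fract (((b : ℕ) : ℝ) * β i) by positivity)
    have b2 := Nat.lt_floor_add_one (N * Int.fract (((b : ℕ) : ℝ) * β i))
    rw [hi] at a1 a2
    rw [abs_lt]
    constructor <;> linarith
  rw [← mul_sub, abs_mul, abs_of_pos hN'] at key
  rw [lt_div_iff₀ hN', mul_comm]
  have he : ((((b : ℕ) - a : ℕ) : ℝ) * β i - ((⌊(b : ℕ) * β i⌋ - ⌊(a : ℕ) * β i⌋ : ℤ) : ℝ)) =
      Int.fract (((b : ℕ) : ℝ) * β i) - Int.fract (((a : ℕ) : ℝ) * β i) := by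
    simp only [Int.fract]
    push_cast [Nat.cast_sub h'.le]
    ring
  rwa [he]

theorem exists_rounding_of_mem_stdSimplex {k : ℕ} {β : Fin k → ℝ} (hβ : β ∈ stdSimplex ℝ (Fin k)) :
    ∃ m : ℕ, 0 < m ∧ ∃ p : Fin k → ℤ, ∑ i, p i = m ∧
      (∀ i, β i = 0 → p i = 0) ∧ ∀ i, 0 < β i → (p i : ℝ) < (m + 1 / 2) * β i := by
  obtain ⟨N, hN, hN0⟩ : ∃ N : ℕ, (∀ i, 0 < β i → 1 / (N : ℝ) < β i / 2) ∧ 0 < N := by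
    refine ((Filter.eventually_all.2 fun i => ?_).and (Filter.eventually_gt_atTop 0)).exists
    by_cases h : 0 < β i
    · filter_upwards [tendsto_one_div_atTop_nhds_zero_nat.eventually_lt_const (half_pos h)]
        with N hN _ using hN
    · exact Filter.Eventually.of_forall fun N h' => absurd h' h
  obtain ⟨m, hm, -, p, hp⟩ := exists_simultaneous_approx hN0 β
  have herr (i) : |m * β i - (if β i = 0 then 0 else p i : ℤ)| ≤ β i / 2 := by
    split_ifs with h
    · simp [h]
    · exact ((hp i).trans (hN i (lt_of_le_of_ne (hβ.1 i) (Ne.symm h)))).le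
  refine ⟨m, hm, fun i => if β i = 0 then 0 else p i, ?_, fun i h => by simp [h], fun i h => ?_⟩
  · have h1 : |∑ i, (m * β i - (if β i = 0 then 0 else p i : ℤ))| ≤ 1 / 2 :=
      calc _ ≤ ∑ i, |m * β i - (if β i = 0 then 0 else p i : ℤ)| := Finset.abs_sum_le_sum_abs _ _
        _ ≤ ∑ i, β i / 2 := Finset.sum_le_sum fun i _ => herr i
        _ = 1 / 2 := by rw [← Finset.sum_div, hβ.2]
    rw [Finset.sum_sub_distrib, ← Finset.mul_sum, hβ.2, mul_one, ← Int.cast_sum] at h1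
    have h2 : |(m : ℤ) - ∑ i, (if β i = 0 then 0 else p i)| < 1 := by
      have : |(m : ℝ) - ((∑ i, (if β i = 0 then 0 else p i) : ℤ) : ℝ)| < 1 := by linarith
      exact_mod_cast this
    exact (sub_eq_zero.1 (Int.abs_lt_one_iff.1 h2)).symm
  · have := abs_lt.1 ((hp i).trans (hN i h))
    simp only [if_neg h.ne']
    linarith [this.1]

theorem exists_bounded_rounding (k : ℕ) :
    ∃ M : ℕ, ∀ β ∈ stdSimplex ℝ (Fin k), ∃ m : ℕ, 0 < m ∧ m ≤ M ∧
      ∃ p : Fin k → ℤ, ∑ i, p i = m ∧ ∀ i, (p i : ℝ) ≤ (m + 1 / 2) * β i := by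
  refine (isCompact_stdSimplex ℝ (Fin k)).induction_on
    (p := fun S => ∃ M : ℕ, ∀ β ∈ S, ∃ m : ℕ, 0 < m ∧ m ≤ M ∧
      ∃ p : Fin k → ℤ, ∑ i, p i = m ∧ ∀ i, (p i : ℝ) ≤ (m + 1 / 2) * β i)
    ⟨0, by simp⟩ ?_ ?_ ?_
  · rintro s t hst ⟨M, hM⟩
    exact ⟨M, fun β hβ => hM β (hst hβ)⟩
  · rintro s t ⟨M, hM⟩ ⟨M', hM'⟩
    refine ⟨max M M', fun β hβ => ?_⟩
    rcases hβ with hβ | hβ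
    · obtain ⟨m, h0, h1, h2⟩ := hM β hβ
      exact ⟨m, h0, h1.trans (le_max_left _ _), h2⟩
    · obtain ⟨m, h0, h1, h2⟩ := hM' β hβ
      exact ⟨m, h0, h1.trans (le_max_right _ _), h2⟩
  · intro β hβ
    obtain ⟨m, hm, p, hsum, hzero, hpos⟩ := exists_rounding_of_mem_stdSimplex hβ
    refine ⟨{γ | ∀ i, (p i : ℝ) ≤ (m + 1 / 2) * γ i}, ?_, m,
      fun γ hγ => ⟨m, hm, le_rfl, p, hsum, hγ⟩⟩
    refine Filter.eventually_all.2 fun i => ?_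
    rcases (hβ.1 i).eq_or_lt with h | h
    · filter_upwards [self_mem_nhdsWithin] with γ hγ
      rw [hzero i h.symm, Int.cast_zero]
      exact mul_nonneg (by positivity) (hγ.1 i)
    · refine Filter.Eventually.filter_mono nhdsWithin_le_nhds ?_
      have hc : Filter.Tendsto (fun γ : Fin k → ℝ => (m + 1 / 2 : ℝ) * γ i) (nhds β)
          (nhds ((m + 1 / 2) * β i)) := Continuous.tendsto (by fun_prop) β
      filter_upwards [hc.eventually_const_lt (hpos i h)] with γ hγ using hγ.le

theorem exists_bounded_rounding_of_card_le (K : ℕ) :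
    ∃ M : ℕ, ∀ (ι : Type) [Fintype ι], Fintype.card ι ≤ K → ∀ β ∈ stdSimplex ℝ ι,
      ∃ m : ℕ, 0 < m ∧ m ≤ M ∧
        ∃ p : ι → ℤ, ∑ i, p i = m ∧ ∀ i, (p i : ℝ) ≤ (m + 1 / 2) * β i := by
  choose M hM using exists_bounded_rounding
  refine ⟨(Finset.range (K + 1)).sup M, fun ι _ hι β hβ => ?_⟩
  let e := Fintype.equivFin ι
  obtain ⟨m, h0, h1, p, h2, h3⟩ := hM (Fintype.card ι) (β ∘ e.symm)
    ⟨fun i => hβ.1 _, by rw [← hβ.2]; exact e.symm.sum_comp β⟩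
  refine ⟨m, h0, h1.trans (Finset.le_sup (by simp; omega)), p ∘ e, ?_, fun i => ?_⟩
  · rw [← h2]; exact e.sum_comp p
  · simpa using h3 (e i)

theorem dotp_eq_dotProduct {n : ℕ} (x y : Fin n → ℝ) : dotp x y = x ⬝ᵥ y := rfl

theorem IsLatticePoint.add {n : ℕ} {x y : Fin n → ℝ} (hx : IsLatticePoint x)
    (hy : IsLatticePoint y) : IsLatticePoint (x + y) := fun i => by
  obtain ⟨a, ha⟩ := hx i
  obtain ⟨b, hb⟩ := hy i
  exact ⟨a + b, by simp [ha, hb]⟩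

theorem IsLatticePoint.zsmul {n : ℕ} {x : Fin n → ℝ} (m : ℤ) (hx : IsLatticePoint x) :
    IsLatticePoint ((m : ℝ) • x) := fun i => by
  obtain ⟨a, ha⟩ := hx i
  exact ⟨m * a, by simp [ha]⟩

theorem IsLatticePoint.sum_zsmul {n : ℕ} {ι : Type*} (s : Finset ι) (p : ι → ℤ)
    {z : ι → Fin n → ℝ} (hz : ∀ i ∈ s, IsLatticePoint (z i)) :
    IsLatticePoint (∑ i ∈ s, (p i : ℝ) • z i) :=
  Finset.sum_induction _ IsLatticePoint (fun _ _ => IsLatticePoint.add)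
    (fun _ => ⟨0, by simp⟩) fun i hi => (hz i hi).zsmul (p i)

theorem exists_dotp_support {n : ℕ} {Δ : Set (Fin n → ℝ)} (hc : Convex ℝ Δ)
    (h0 : 0 ∈ interior Δ) {w : Fin n → ℝ} (hw : w ∉ interior Δ) :
    ∃ u, dotp w u = 1 ∧ ∀ x ∈ Δ, dotp x u ≤ 1 := by
  obtain ⟨f, hf⟩ := geometric_hahn_banach_open_point hc.interior isOpen_interior hw
  have hpos : 0 < f w := by simpa using hf 0 h0
  have hle : ∀ x ∈ Δ, f x ≤ f w := fun x hx => by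
    have hx' : x ∈ closure (interior Δ) := by
      rw [hc.closure_interior_eq_closure_of_nonempty_interior ⟨0, h0⟩]
      exact subset_closure hx
    exact closure_minimal (fun y hy => (hf y hy).le)
      (isClosed_le f.continuous continuous_const) hx'
  have hrep (x : Fin n → ℝ) : dotp x (fun i => f (Pi.single i 1) / f w) = f x / f w := by
    conv_rhs => rw [pi_eq_sum_univ' x]
    simp [dotp, Finset.sum_div, mul_div_assoc]
  refine ⟨_, (hrep w).trans (div_self hpos.ne'), fun x hx => ?_⟩
  rw [hrep, div_le_one hpos]
  exact hle x hx

theorem gauge_sum_smul_le {n : ℕ} {Δ : Set (Fin n → ℝ)} (hc : Convex ℝ Δ) (h0 : Δ ∈ nhds 0)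
    {ι : Type*} (s : Finset ι) {a : ι → ℝ} (ha : ∀ i, 0 ≤ a i) {z : ι → Fin n → ℝ} {C : ℝ}
    (hz : ∀ i ∈ s, gauge Δ (z i) ≤ C) :
    gauge Δ (∑ i ∈ s, a i • z i) ≤ (∑ i ∈ s, a i) * C := by
  refine (gauge_sum_le hc (absorbent_nhds_zero h0) s _).trans ?_
  rw [Finset.sum_mul]
  refine Finset.sum_le_sum fun i hi => ?_
  rw [gauge_smul_of_nonneg (ha i), smul_eq_mul]
  exact mul_le_mul_of_nonneg_left (hz i hi) (ha i)

/-- A lattice polytope whose only interior lattice point is the origin is not too asymmetric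
about the origin. -/
theorem exists_gauge_neg_le (n : ℕ) : ∃ C : ℕ, ∀ V : Set (Fin n → ℝ), V.Finite →
    (∀ v ∈ V, IsLatticePoint v) → 0 ∈ interior (convexHull ℝ V) →
    (∀ x ∈ interior (convexHull ℝ V), IsLatticePoint x → x = 0) →
    ∀ v ∈ V, gauge (convexHull ℝ V) (-v) ≤ C := by
  obtain ⟨M, hM⟩ := exists_bounded_rounding_of_card_le (n + 1)
  refine ⟨2 * M + 2, fun V hfin hV h0 hint v hv => ?_⟩
  have hc := convex_convexHull ℝ V
  have hnhds : convexHull ℝ V ∈ nhds 0 := mem_interior_iff_mem_nhds.1 h0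
  by_contra! hlt
  set t := gauge (convexHull ℝ V) (-v) with ht
  push_cast at hlt
  have ht0 : 0 < t := lt_of_le_of_lt (by positivity) hlt
  have hw1 : gauge (convexHull ℝ V) (t⁻¹ • -v) = 1 := by
    rw [gauge_smul_of_nonneg (inv_nonneg.2 ht0.le), ← ht, smul_eq_mul, inv_mul_cancel₀ ht0.ne']
  have hwmem : t⁻¹ • -v ∈ convexHull ℝ V := by
    rw [← (hfin.isClosed_convexHull ℝ).closure_eq]
    exact (gauge_le_one_iff_mem_closure hc hnhds).1 hw1.le
  obtain ⟨u, huw, hu⟩ := exists_dotp_support hc h0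
    (fun h => hw1.not_lt ((gauge_lt_one_iff_mem_interior hc hnhds).2 h))
  obtain ⟨ι, _, z, β, hzV, hind, hβ0, hβ1, hβz⟩ := eq_pos_convex_span_of_mem_convexHull hwmem
  have hcard : Fintype.card ι ≤ n + 1 := hind.card_le_finrank_succ.trans <| by
    simpa using (vectorSpan ℝ (Set.range z)).finrank_le
  have hzmem (i : ι) : z i ∈ V := hzV ⟨i, rfl⟩
  have hzΔ (i : ι) : z i ∈ convexHull ℝ V := subset_convexHull ℝ V (hzmem i)
  have hzu (i : ι) : dotp (z i) u = 1 := by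
    have hsum : ∑ i, β i * (1 - dotp (z i) u) = 0 := by
      rw [← hβz] at huw
      simp only [dotp_eq_dotProduct, sum_dotProduct, smul_dotProduct, smul_eq_mul] at huw ⊢
      simp [mul_sub, hβ1, huw]
    have := (Finset.sum_eq_zero_iff_of_nonneg fun i _ =>
      mul_nonneg (hβ0 i).le (sub_nonneg.2 (hu _ (hzΔ i)))).1 hsum i (Finset.mem_univ i)
    rcases mul_eq_zero.1 this with h | h
    · exact absurd h (hβ0 i).ne'
    · linarith
  obtain ⟨m, hm0, hmM, p, hpm, hp⟩ := hM ι hcard β ⟨fun i => (hβ0 i).le, hβ1⟩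
  have hpm' : ∑ i, (p i : ℝ) = m := by exact_mod_cast hpm
  have hmM' : (m : ℝ) ≤ M := by exact_mod_cast hmM
  have hx : ∑ i, ((-p i : ℤ) : ℝ) • z i =
      ∑ i, ((m + 1 / 2) * β i - p i) • z i + ((m + 1 / 2) / t) • v := by
    have : ∑ i, ((m + 1 / 2 : ℝ) * β i) • z i = -(((m + 1 / 2) / t) • v) := by
      simp_rw [mul_smul, ← Finset.smul_sum, hβz]
      rw [smul_neg, smul_neg, smul_smul, ← div_eq_mul_inv]
    simp only [sub_smul, Finset.sum_sub_distrib, this, Int.cast_neg, neg_smul,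
      Finset.sum_neg_distrib]
    abel
  have hs : (m + 1 / 2) / t < 1 / 2 := by
    rw [div_lt_iff₀ ht0]
    linarith
  have hlt1 : gauge (convexHull ℝ V) (∑ i, ((-p i : ℤ) : ℝ) • z i) < 1 := by
    rw [hx]
    refine (gauge_add_le hc (absorbent_nhds_zero hnhds) _ _).trans_lt ?_
    have h1 := gauge_sum_smul_le hc hnhds Finset.univ (fun i => sub_nonneg.2 (hp i))
      fun i _ => gauge_le_one_of_mem (hzΔ i)
    have h2 : gauge (convexHull ℝ V) (((m + 1 / 2) / t) • v) ≤ (m + 1 / 2) / t := by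
      rw [gauge_smul_of_nonneg (by positivity), smul_eq_mul]
      exact mul_le_of_le_one_right (by positivity)
        (gauge_le_one_of_mem (subset_convexHull ℝ V hv))
    rw [Finset.sum_sub_distrib, ← Finset.mul_sum, hβ1, hpm'] at h1
    linarith
  have hzero := hint _ ((gauge_lt_one_iff_mem_interior hc hnhds).1 hlt1)
    (IsLatticePoint.sum_zsmul _ _ fun i _ => hV _ (hzmem i))
  have hdot := congrArg (fun x => dotp x u) hzero
  simp only [dotp_eq_dotProduct, sum_dotProduct, smul_dotProduct, zero_dotProduct] at hdot hzu
  simp only [hzu, smul_eq_mul, mul_one, Int.cast_neg, Finset.sum_neg_distrib, hpm',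
    neg_eq_zero, Nat.cast_eq_zero] at hdot
  omega

theorem isCompact_dual_slice {n : ℕ} {V : Set (Fin n → ℝ)} (h0 : 0 ∈ interior (convexHull ℝ V))
    (w : Fin n → ℝ) :
    IsCompact {u : Fin n → ℝ | dotp w u = 1 ∧ ∀ x ∈ convexHull ℝ V, dotp x u ≤ 1} := by
  have hcont (x : Fin n → ℝ) : Continuous fun u => dotp x u := by
    unfold dotp
    fun_prop
  have hclosed : IsClosed {u : Fin n → ℝ | dotp w u = 1 ∧ ∀ x ∈ convexHull ℝ V, dotp x u ≤ 1} := by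
    simp only [Set.ofPred_and, Set.ofPred_forall]
    exact (isClosed_eq (hcont w) continuous_const).inter
      (isClosed_biInter fun x _ => isClosed_le (hcont x) continuous_const)
  obtain ⟨r, hr, hball⟩ := Metric.mem_nhds_iff.1 (mem_interior_iff_mem_nhds.1 h0)
  refine Metric.isCompact_of_isClosed_isBounded hclosed
    (isBounded_iff_forall_norm_le.2 ⟨2 / r, fun u hu => ?_⟩)
  have key (s : ℝ) (hs : |s| < r) (i : Fin n) : s * u i ≤ 1 := by
    have := hu.2 (Pi.single i s) (hball (by
      rw [mem_ball_zero_iff]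
      simpa [Pi.norm_single] using hs))
    simpa [dotp_eq_dotProduct] using this
  rw [pi_norm_le_iff_of_nonneg (by positivity)]
  intro i
  have h1 := key (r / 2) (by rw [abs_of_pos] <;> linarith) i
  have h2 := key (-(r / 2)) (by rw [abs_neg, abs_of_pos] <;> linarith) i
  rw [Real.norm_eq_abs, abs_le, ← neg_div, div_le_iff₀ hr, le_div_iff₀ hr]
  constructor <;> linarith

/-- Every boundary point of a full-dimensional polytope around the origin lies on a face whose
linear span is the whole space. -/
theorem exists_isFaceOf_span_eq_top {n : ℕ} {V : Set (Fin n → ℝ)} (hfin : V.Finite)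
    (h0 : 0 ∈ interior (convexHull ℝ V)) {w : Fin n → ℝ} (hw : w ∈ convexHull ℝ V)
    (hw' : w ∉ interior (convexHull ℝ V)) :
    ∃ u, dotp w u = 1 ∧ (∀ x ∈ convexHull ℝ V, dotp x u ≤ 1) ∧
      Submodule.span ℝ {x ∈ convexHull ℝ V | dotp x u = 1} = ⊤ := by
  obtain ⟨u₀, hu₀⟩ := exists_dotp_support (convex_convexHull ℝ V) h0 hw'
  obtain ⟨u, hu⟩ := (isCompact_dual_slice h0 w).extremePoints_nonempty ⟨u₀, hu₀⟩
  rw [mem_extremePoints] at hu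
  obtain ⟨⟨huw, hu1⟩, hext⟩ := hu
  refine ⟨u, huw, hu1, ?_⟩
  by_contra hne
  obtain ⟨f, hf0, hf⟩ := Submodule.exists_le_ker_of_lt_top _ (lt_top_iff_ne_top.2 hne)
  let y : Fin n → ℝ := fun i => f (Pi.single i 1)
  have hfy (x : Fin n → ℝ) : dotp x y = f x := by
    conv_rhs => rw [pi_eq_sum_univ' x]
    simp [dotp, y]
  have hy0 : y ≠ 0 := fun h => hf0 (LinearMap.ext fun x => by
    rw [← hfy x, h]
    simp [dotp])
  have hker (x) (hx : x ∈ convexHull ℝ V) (hxu : dotp x u = 1) : dotp x y = 0 := by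
    rw [hfy]
    exact hf (Submodule.subset_span ⟨hx, hxu⟩)
  have hlin (x : Fin n → ℝ) (s : ℝ) : dotp x (u + s • y) = dotp x u + s * dotp x y := by
    simp [dotp_eq_dotProduct, dotProduct_add]
  have hev : ∀ᶠ s : ℝ in nhds 0, ∀ v ∈ V, dotp v (u + s • y) ≤ 1 := by
    refine (Filter.eventually_all_finite hfin).2 fun v hv => ?_
    have hvΔ := subset_convexHull ℝ V hv
    rcases (hu1 v hvΔ).eq_or_lt with h | h
    · exact Filter.Eventually.of_forall fun s => by rw [hlin, hker v hvΔ h, h]; simp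
    · have hc : Filter.Tendsto (fun s : ℝ => dotp v u + s * dotp v y) (nhds 0)
          (nhds (dotp v u + 0 * dotp v y)) := Continuous.tendsto (by fun_prop) 0
      filter_upwards [hc.eventually_lt_const (by simpa using h)] with s hs
      rw [hlin]
      exact hs.le
  have hmem {s : ℝ} (hs : ∀ v ∈ V, dotp v (u + s • y) ≤ 1) :
      u + s • y ∈ {u : Fin n → ℝ | dotp w u = 1 ∧ ∀ x ∈ convexHull ℝ V, dotp x u ≤ 1} := by
    refine ⟨by rw [hlin, hker w hw huw, huw]; simp, fun x hx => ?_⟩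
    have hconv : Convex ℝ {x : Fin n → ℝ | dotp x (u + s • y) ≤ 1} :=
      convex_halfSpace_le ⟨fun a b => add_dotProduct a b _, fun c a => smul_dotProduct c a _⟩ 1
    exact convexHull_min hs hconv hx
  have hev' := hev.and ((continuous_neg.tendsto' (0 : ℝ) 0 neg_zero).eventually hev)
  obtain ⟨ε, hε, hball⟩ := Metric.eventually_nhds_iff.1 hev'
  obtain ⟨h1, h2⟩ := hball (y := ε / 2) (by rw [Real.dist_eq, sub_zero, abs_of_pos] <;> linarith)
  have := (hext _ (hmem h1) _ (hmem h2) ⟨1 / 2, 1 / 2, by norm_num, by norm_num, by norm_num, by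
    ext i; simp; ring⟩).1
  simp [hε.ne', hy0] at this

theorem faceDim_add_one_eq {n : ℕ} {F : Set (Fin n → ℝ)} {u w : Fin n → ℝ} (hw : w ∈ F)
    (hF : ∀ x ∈ F, dotp x u = 1) (hspan : Submodule.span ℝ F = ⊤) : faceDim F + 1 = n := by
  have hw0 : w ≠ 0 := fun h => by simpa [h, dotp] using hF w hw
  have hsup : vectorSpan ℝ F ⊔ Submodule.span ℝ {w} = ⊤ := by
    rw [eq_top_iff, ← hspan, Submodule.span_le]
    intro x hx
    rw [← sub_add_cancel x w]
    exact Submodule.add_mem_sup (vsub_mem_vectorSpan ℝ hx hw) (Submodule.mem_span_singleton_self w)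
  have hle : ∀ y ∈ vectorSpan ℝ F, dotp y u = 0 := by
    refine fun y hy => Submodule.span_induction ?_ ?_ ?_ ?_ hy
    · rintro _ ⟨a, ha, b, hb, rfl⟩
      have h1 := hF a ha
      have h2 := hF b hb
      simp only [dotp_eq_dotProduct] at h1 h2 ⊢
      rw [vsub_eq_sub, sub_dotProduct, h1, h2, sub_self]
    · simp [dotp]
    · intro a b _ _ ha hb
      simp only [dotp_eq_dotProduct] at ha hb ⊢
      rw [add_dotProduct, ha, hb, add_zero]
    · intro c a _ ha
      simp only [dotp_eq_dotProduct] at ha ⊢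
      rw [smul_dotProduct, ha, smul_zero]
  have hinf : vectorSpan ℝ F ⊓ Submodule.span ℝ {w} = ⊥ := by
    rw [eq_bot_iff]
    rintro y ⟨hy, hyw⟩
    obtain ⟨c, rfl⟩ := Submodule.mem_span_singleton.1 hyw
    have h1 := hle _ hy
    have h2 := hF w hw
    simp only [dotp_eq_dotProduct] at h1 h2
    rw [smul_dotProduct, h2, smul_eq_mul, mul_one] at h1
    simp [h1]
  have := Submodule.finrank_sup_add_finrank_inf_eq (vectorSpan ℝ F) (Submodule.span ℝ {w})
  rw [hsup, hinf, finrank_span_singleton hw0] at this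
  simpa [faceDim] using this.symm

theorem IsReflexive.eq_zero_of_mem_interior {n : ℕ} {Δ : Set (Fin n → ℝ)} (hΔ : IsReflexive Δ)
    {x : Fin n → ℝ} (hx : x ∈ interior Δ) (hlat : IsLatticePoint x) : x = 0 := by
  obtain ⟨⟨V, hfin, hV, rfl⟩, h0, hfacet⟩ := hΔ
  have hc := convex_convexHull ℝ V
  have hnhds : convexHull ℝ V ∈ nhds 0 := mem_interior_iff_mem_nhds.1 h0
  by_contra hne
  have hpos : 0 < gauge (convexHull ℝ V) x :=
    (gauge_pos (absorbent_nhds_zero hnhds)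
      (NormedSpace.isVonNBounded_of_isBounded ℝ (hfin.isCompact_convexHull ℝ).isBounded)).2 hne
  have hlt := (gauge_lt_one_iff_mem_interior hc hnhds).2 hx
  set g := gauge (convexHull ℝ V) x with hg
  have hw1 : gauge (convexHull ℝ V) (g⁻¹ • x) = 1 := by
    rw [gauge_smul_of_nonneg (inv_nonneg.2 hpos.le), ← hg, smul_eq_mul, inv_mul_cancel₀ hpos.ne']
  have hwmem : g⁻¹ • x ∈ convexHull ℝ V := by
    rw [← (hfin.isClosed_convexHull ℝ).closure_eq]
    exact (gauge_le_one_iff_mem_closure hc hnhds).1 hw1.le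
  obtain ⟨u, huw, hu, hspan⟩ := exists_isFaceOf_span_eq_top hfin h0 hwmem
    (fun h => hw1.not_lt ((gauge_lt_one_iff_mem_interior hc hnhds).2 h))
  obtain ⟨l, hl⟩ := hfacet {x ∈ convexHull ℝ V | dotp x u = 1} ⟨⟨_, hwmem, huw⟩, u, 1, hu, rfl⟩
    (faceDim_add_one_eq ⟨hwmem, huw⟩ (fun x hx => hx.2) hspan)
  have hlw : dotp (g⁻¹ • x) (fun i => (l i : ℝ)) = -1 := hl ⟨hwmem, huw⟩
  rw [dotp_eq_dotProduct, smul_dotProduct, smul_eq_mul, inv_mul_eq_iff_eq_mul₀ hpos.ne',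
    mul_neg_one] at hlw
  choose a ha using hlat
  have hint : ((∑ i, a i * l i : ℤ) : ℝ) = -g := by
    rw [← hlw]
    simp [dotProduct, ha]
  have h1 : (∑ i, a i * l i : ℤ) < 0 := by
    have : ((∑ i, a i * l i : ℤ) : ℝ) < 0 := by linarith
    exact_mod_cast this
  have h2 : (-1 : ℤ) < ∑ i, a i * l i := by
    have : (((-1 : ℤ)) : ℝ) < ((∑ i, a i * l i : ℤ) : ℝ) := by push_cast at hint ⊢; linarith
    exact_mod_cast this
  omega

open Matrix in
/-- A basis of `ℝⁿ`, given by the columns of `B`, consisting of lattice points, in which the points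
of `V` have coordinates in `[-1, 1]` and all lattice points have coordinates in `(1 / D) ℤ`. -/
structure IsFrame {n : ℕ} (D : ℕ) (V : Set (Fin n → ℝ)) (B : Matrix (Fin n) (Fin n) ℝ) : Prop where
  isUnit_det : IsUnit B.det
  isLatticePoint_col : ∀ j, IsLatticePoint (B.col j)
  isLatticePoint_of_mem : ∀ v ∈ V, IsLatticePoint v
  exists_int_coord : ∀ x, IsLatticePoint x → ∀ i, ∃ z : ℤ, (D : ℝ) * (B⁻¹ *ᵥ x) i = z
  abs_coord_le_one : ∀ v ∈ V, ∀ i, |(B⁻¹ *ᵥ v) i| ≤ 1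

theorem Matrix.mulVec_eq_sum_smul_col {n : ℕ} (B : Matrix (Fin n) (Fin n) ℝ) (x : Fin n → ℝ) :
    B.mulVec x = ∑ j, x j • B.col j := by
  ext i
  simp [Matrix.mulVec, dotProduct, mul_comm]

open Matrix in
theorem exists_mem_basis_abs_coord_le_one {n : ℕ} {V : Set (Fin n → ℝ)} (hfin : V.Finite)
    (h0 : 0 ∈ interior (convexHull ℝ V)) :
    ∃ B : Matrix (Fin n) (Fin n) ℝ, IsUnit B.det ∧ (∀ j, B.col j ∈ V) ∧
      ∀ v ∈ V, ∀ i, |(B⁻¹ *ᵥ v) i| ≤ 1 := by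
  have hspan : Submodule.span ℝ V = ⊤ :=
    Submodule.eq_top_of_nonempty_interior' _ ⟨0, interior_mono (convexHull_min
      Submodule.subset_span (Submodule.span ℝ V).convex) h0⟩
  obtain ⟨f, hfV, -, hf⟩ := Submodule.exists_fun_fin_finrank_span_eq ℝ V
  have hrank : n = Module.finrank ℝ (Submodule.span ℝ V) := by
    rw [hspan, finrank_top, Module.finrank_fin_fun]
  have hind := hf.comp (Fin.cast hrank) (Fin.cast_injective hrank)
  have hdet : (of (f ∘ Fin.cast hrank)).det ≠ 0 := by
    rw [← isUnit_iff_ne_zero, ← isUnit_iff_isUnit_det, ← linearIndependent_rows_iff_isUnit]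
    exact hind
  have := hfin.to_subtype
  let b₀ : Fin n → V := fun i => ⟨f (Fin.cast hrank i), hfV _⟩
  have : Nonempty (Fin n → V) := ⟨b₀⟩
  obtain ⟨b, hb⟩ := Finite.exists_max fun b : Fin n → V => |(of fun i => (b i : Fin n → ℝ)).det|
  have hbdet : (of fun i => (b i : Fin n → ℝ)).det ≠ 0 :=
    abs_pos.1 ((abs_pos.2 hdet).trans_le (hb b₀))
  have hunit : IsUnit (of fun i => (b i : Fin n → ℝ))ᵀ.det := by
    rwa [det_transpose, isUnit_iff_ne_zero]
  refine ⟨(of fun i => (b i : Fin n → ℝ))ᵀ, hunit, fun j => (b j).2, fun v hv i => ?_⟩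
  have h1 := congrFun (det_smul_inv_mulVec_eq_cramer _ v hunit) i
  have h2 := hb (Function.update b i ⟨v, hv⟩)
  have h3 : (of fun j => (Function.update b i ⟨v, hv⟩ j : Fin n → ℝ)) =
      updateRow (of fun i => (b i : Fin n → ℝ)) i v := by
    ext j k
    by_cases h : j = i <;> simp [h, updateRow_apply]
  rw [cramer_transpose_apply, Pi.smul_apply, smul_eq_mul, det_transpose] at h1
  change (of fun i => (b i : Fin n → ℝ)).det * _ =
    (updateRow (of fun i => (b i : Fin n → ℝ)) i v).det at h1
  simp only [h3, ← h1, abs_mul] at h2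
  exact (mul_le_iff_le_one_right (abs_pos.2 hbdet)).1 h2

open Matrix in
theorem exists_isFrame (n : ℕ) : ∃ D : ℕ, 0 < D ∧ ∀ V : Set (Fin n → ℝ), V.Finite →
    (∀ v ∈ V, IsLatticePoint v) → 0 ∈ interior (convexHull ℝ V) →
    (∀ x ∈ interior (convexHull ℝ V), IsLatticePoint x → x = 0) → ∃ B, IsFrame D V B := by
  obtain ⟨C, hC⟩ := exists_gauge_neg_le n
  let N := n * (C + 1) + 1
  refine ⟨(N ^ n).factorial, Nat.factorial_pos _, fun V hfin hV h0 hint => ?_⟩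
  obtain ⟨B, hdet, hcol, hle⟩ := exists_mem_basis_abs_coord_le_one hfin h0
  refine ⟨B, hdet, fun j => hV _ (hcol j), hV, fun x hx => ?_, hle⟩
  have hc := convex_convexHull ℝ V
  have hnhds : convexHull ℝ V ∈ nhds 0 := mem_interior_iff_mem_nhds.1 h0
  have hN : (0 : ℝ) < N := by positivity
  obtain ⟨m, hm0, hmN, p, hp⟩ := exists_simultaneous_approx (N := N) (by positivity) (B⁻¹ *ᵥ x)
  set e : Fin n → ℝ := fun i => m * (B⁻¹ *ᵥ x) i - p i with he
  have hBe : B *ᵥ e = (m : ℝ) • x + ∑ j, ((-p j : ℤ) : ℝ) • B.col j := by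
    have : e = (m : ℝ) • (B⁻¹ *ᵥ x) - fun i => (p i : ℝ) := rfl
    rw [this, mulVec_sub, mulVec_smul, mulVec_mulVec, mul_nonsing_inv _ hdet, one_mulVec,
      mulVec_eq_sum_smul_col B fun i => (p i : ℝ)]
    simp [sub_eq_add_neg]
  have hlat : IsLatticePoint (B *ᵥ e) := by
    rw [hBe]
    exact (hx.zsmul m).add (IsLatticePoint.sum_zsmul _ _ fun j _ => hV _ (hcol j))
  have hg : gauge (convexHull ℝ V) (B *ᵥ e) < 1 := by
    have h1 : B *ᵥ e = ∑ j, |e j| • (if 0 ≤ e j then B.col j else -B.col j) := by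
      rw [mulVec_eq_sum_smul_col]
      refine Finset.sum_congr rfl fun j _ => ?_
      split_ifs with h
      · rw [abs_of_nonneg h]
      · rw [abs_of_neg (not_le.1 h), neg_smul_neg]
    have h2 := gauge_sum_smul_le hc hnhds Finset.univ (fun j => abs_nonneg (e j))
      (z := fun j => if 0 ≤ e j then B.col j else -B.col j) (C := C + 1) fun j _ => by
        have h3 := gauge_le_one_of_mem (subset_convexHull ℝ V (hcol j))
        have h4 := hC V hfin hV h0 hint _ (hcol j)
        have h5 : (0 : ℝ) ≤ C := by positivity
        split_ifs <;> linarith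
    rw [← h1] at h2
    have h6 : ∑ j, |e j| ≤ n * (1 / N) := by
      simpa using Finset.sum_le_sum fun j (_ : j ∈ Finset.univ) => (hp j).le
    calc _ ≤ _ := h2
      _ ≤ n * (1 / N) * (C + 1) := by gcongr
      _ = (n * (C + 1)) / N := by ring
      _ < 1 := by
        rw [div_lt_one hN]
        push_cast [N]
        linarith
  have he0 : e = 0 := by
    have h1 := hint _ ((gauge_lt_one_iff_mem_interior hc hnhds).1 hg) hlat
    have h2 := congrArg (B⁻¹ *ᵥ ·) h1
    simpa [mulVec_mulVec, nonsing_inv_mul _ hdet] using h2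
  intro i
  obtain ⟨k, hk⟩ := Nat.dvd_factorial hm0 hmN
  refine ⟨k * p i, ?_⟩
  have h1 : m * (B⁻¹ *ᵥ x) i - p i = 0 := congrFun he0 i
  rw [hk]
  push_cast
  linear_combination (k : ℝ) * h1

open Matrix in
/-- The integral coordinate vectors, scaled by `D` and lying in the box `[-D, D]ⁿ`, of the points of
a set `S` with respect to the columns of `B`. -/
def boxCoords {n : ℕ} (D : ℕ) (B : Matrix (Fin n) (Fin n) ℝ) (S : Set (Fin n → ℝ)) :
    Set (Fin n → Finset.Icc (-D : ℤ) D) :=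
  {q | ∃ x ∈ S, ∀ i, (D : ℝ) * (B⁻¹ *ᵥ x) i = (q i : ℤ)}

open Matrix in
theorem IsFrame.exists_of_boxCoords_subset {n D : ℕ} (hD : 0 < D) {V S S' : Set (Fin n → ℝ)}
    {B B' : Matrix (Fin n) (Fin n) ℝ} (hB : IsFrame D V B) (hB' : IsUnit B'.det)
    (h : boxCoords D B S ⊆ boxCoords D B' S') {x : Fin n → ℝ} (hx : x ∈ S)
    (hlat : IsLatticePoint x) (hbox : ∀ i, |(B⁻¹ *ᵥ x) i| ≤ 1) : (B' * B⁻¹) *ᵥ x ∈ S' := by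
  have hD' : (0 : ℝ) < D := by exact_mod_cast hD
  choose z hz using hB.exists_int_coord x hlat
  have hmem (i : Fin n) : z i ∈ Finset.Icc (-D : ℤ) D := by
    have h1 : |(z i : ℝ)| ≤ D := by
      rw [← hz, abs_mul, abs_of_pos hD']
      exact mul_le_of_le_one_right hD'.le (hbox i)
    rw [Finset.mem_Icc, ← abs_le]
    exact_mod_cast h1
  obtain ⟨y, hy, hyz⟩ := h (a := fun i => ⟨z i, hmem i⟩) ⟨x, hx, hz⟩
  have hxy : B⁻¹ *ᵥ x = B'⁻¹ *ᵥ y := by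
    ext i
    exact mul_left_cancel₀ hD'.ne' ((hz i).trans (hyz i).symm)
  rwa [← mulVec_mulVec, hxy, mulVec_mulVec, mul_nonsing_inv _ hB', one_mulVec]

open Matrix in
theorem IsFrame.isLatticePoint_mulVec {n D : ℕ} (hD : 0 < D) {V V' : Set (Fin n → ℝ)}
    {B B' : Matrix (Fin n) (Fin n) ℝ} (hB : IsFrame D V B) (hB' : IsFrame D V' B')
    (h : boxCoords D B {x | IsLatticePoint x} ⊆ boxCoords D B' {x | IsLatticePoint x})
    {x : Fin n → ℝ} (hx : IsLatticePoint x) : IsLatticePoint ((B' * B⁻¹) *ᵥ x) := by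
  set c := B⁻¹ *ᵥ x with hc
  let y := x + ∑ j, ((-⌊c j⌋ : ℤ) : ℝ) • B.col j
  have hy : IsLatticePoint y :=
    hx.add (IsLatticePoint.sum_zsmul _ _ fun j _ => hB.isLatticePoint_col j)
  have hxy : x = y + B *ᵥ (fun j => (⌊c j⌋ : ℝ)) := by
    simp [y, mulVec_eq_sum_smul_col]
  have hyc : B⁻¹ *ᵥ y = fun i => Int.fract (c i) := by
    have : c = B⁻¹ *ᵥ y + fun j => (⌊c j⌋ : ℝ) := by
      conv_lhs => rw [hc, hxy]
      rw [mulVec_add, mulVec_mulVec, nonsing_inv_mul _ hB.isUnit_det, one_mulVec]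
    exact eq_sub_of_add_eq this.symm
  have hmem := hB.exists_of_boxCoords_subset hD hB'.isUnit_det h (x := y) hy hy fun i => by
    rw [hyc, abs_of_nonneg (Int.fract_nonneg _)]
    exact (Int.fract_lt_one _).le
  rw [hxy, mulVec_add, mulVec_mulVec, Matrix.mul_assoc, nonsing_inv_mul _ hB.isUnit_det,
    Matrix.mul_one, mulVec_eq_sum_smul_col B']
  exact IsLatticePoint.add hmem
    (IsLatticePoint.sum_zsmul _ _ fun j _ => hB'.isLatticePoint_col j)

open Matrix in
theorem IsFrame.exists_int_matrix {n D : ℕ} (hD : 0 < D) {V V' : Set (Fin n → ℝ)}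
    {B B' : Matrix (Fin n) (Fin n) ℝ} (hB : IsFrame D V B) (hB' : IsFrame D V' B')
    (h : boxCoords D B {x | IsLatticePoint x} ⊆ boxCoords D B' {x | IsLatticePoint x}) :
    ∃ A : Matrix (Fin n) (Fin n) ℤ, A.map (fun z : ℤ => (z : ℝ)) = B' * B⁻¹ := by
  have hint (i j : Fin n) : ∃ z : ℤ, (B' * B⁻¹) i j = z := by
    have hlat : IsLatticePoint (Pi.single j 1 : Fin n → ℝ) := fun k =>
      ⟨Pi.single (M := fun _ => ℤ) j 1 k, by by_cases hk : k = j <;> simp [hk]⟩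
    have := hB.isLatticePoint_mulVec hD hB' h hlat i
    rwa [mulVec_single_one] at this
  choose A hA using hint
  exact ⟨of A, by ext i j; simp [hA]⟩

open Matrix in
theorem IsFrame.exists_unimodular {n D : ℕ} (hD : 0 < D) {V V' : Set (Fin n → ℝ)}
    {B B' : Matrix (Fin n) (Fin n) ℝ} (hB : IsFrame D V B) (hB' : IsFrame D V' B')
    (hlat : boxCoords D B {x | IsLatticePoint x} = boxCoords D B' {x | IsLatticePoint x})
    (hV : boxCoords D B V = boxCoords D B' V') :
    ∃ A : Matrix (Fin n) (Fin n) ℤ, IsUnit A.det ∧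
      V' = (fun x => (A.map (fun z : ℤ => (z : ℝ))).mulVec x) '' V := by
  obtain ⟨A, hA⟩ := hB.exists_int_matrix hD hB' hlat.subset
  obtain ⟨A', hA'⟩ := hB'.exists_int_matrix hD hB hlat.symm.subset
  have hcancel : (B' * B⁻¹) * (B * B'⁻¹) = 1 := by
    rw [Matrix.mul_assoc, ← Matrix.mul_assoc B⁻¹, nonsing_inv_mul _ hB.isUnit_det, Matrix.one_mul,
      mul_nonsing_inv _ hB'.isUnit_det]
  refine ⟨A, isUnit_det_of_right_inverse (B := A') ?_, ?_⟩
  · apply Matrix.map_injective (Int.cast_injective (α := ℝ))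
    have := Matrix.map_mul (L := A) (M := A') (f := Int.castRingHom ℝ)
    refine this.trans ?_
    change A.map (fun z : ℤ => (z : ℝ)) * A'.map (fun z : ℤ => (z : ℝ)) = _
    rw [hA, hA', hcancel]
    simp
  · rw [hA]
    apply Set.Subset.antisymm
    · intro y hy
      refine ⟨(B * B'⁻¹) *ᵥ y, hB'.exists_of_boxCoords_subset hD hB.isUnit_det hV.symm.subset hy
        (hB'.isLatticePoint_of_mem y hy) (hB'.abs_coord_le_one y hy), ?_⟩
      simp only
      rw [mulVec_mulVec, hcancel, one_mulVec]
    · rintro _ ⟨x, hx, rfl⟩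
      exact hB.exists_of_boxCoords_subset hD hB'.isUnit_det hV.subset hx
        (hB.isLatticePoint_of_mem x hx) (hB.abs_coord_le_one x hx)

/-- For every positive integer `n` there are, up to the action of `GLₙ(ℤ)`,
only finitely many `n`-dimensional reflexive polytopes: there is a finite list of reflexive
polytopes in `ℝⁿ` such that every reflexive polytope is the image of one of them under a
matrix `A ∈ GLₙ(ℤ)` (an integer matrix with `det A = ±1`). -/
theorem finitely_many_reflexive_polytopes (n : ℕ) (hn : 0 < n) :
    ∃ L : Finset (Set (Fin n → ℝ)),
      (∀ Δ ∈ L, IsReflexive Δ) ∧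
      ∀ Δ : Set (Fin n → ℝ), IsReflexive Δ →
        ∃ Δ' ∈ L, ∃ A : Matrix (Fin n) (Fin n) ℤ, IsUnit A.det ∧
          Δ = (fun x => (A.map (fun z : ℤ => (z : ℝ))).mulVec x) '' Δ' := by
  obtain ⟨D, hD, hframe⟩ := exists_isFrame n
  have hdata (Δ : {Δ : Set (Fin n → ℝ) // IsReflexive Δ}) :
      ∃ V B, (Δ : Set (Fin n → ℝ)) = convexHull ℝ V ∧ IsFrame D V B := by
    obtain ⟨Δ, hΔ⟩ := Δ
    obtain ⟨V, hfin, hV, rfl⟩ := hΔ.1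
    obtain ⟨B, hB⟩ := hframe V hfin hV hΔ.2.1 fun x hx hlat => hΔ.eq_zero_of_mem_interior hx hlat
    exact ⟨V, B, rfl, hB⟩
  choose V B hV hB using hdata
  let f (Δ : {Δ : Set (Fin n → ℝ) // IsReflexive Δ}) :=
    (boxCoords D (B Δ) {x | IsLatticePoint x}, boxCoords D (B Δ) (V Δ))
  let g (q : Set.range f) : Set (Fin n → ℝ) := (Set.rangeSplitting f q).1
  refine ⟨(Set.finite_range g).toFinset, fun Δ hΔ => ?_, fun Δ hΔ => ?_⟩
  · obtain ⟨q, rfl⟩ := (Set.finite_range g).mem_toFinset.1 hΔ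
    exact (Set.rangeSplitting f q).2
  · let q : Set.range f := ⟨f ⟨Δ, hΔ⟩, ⟨Δ, hΔ⟩, rfl⟩
    have hq : f (Set.rangeSplitting f q) = f ⟨Δ, hΔ⟩ := Set.apply_rangeSplitting f q
    obtain ⟨A, hA, hAV⟩ := (hB (Set.rangeSplitting f q)).exists_unimodular hD (hB ⟨Δ, hΔ⟩)
      (congrArg Prod.fst hq) (congrArg Prod.snd hq)
    refine ⟨g q, (Set.finite_range g).mem_toFinset.2 ⟨q, rfl⟩, A, hA, ?_⟩
    calc Δ = convexHull ℝ (V ⟨Δ, hΔ⟩) := hV ⟨Δ, hΔ⟩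
      _ = _ := by
        rw [hAV, show g q = _ from hV _]
        exact ((A.map fun z : ℤ => (z : ℝ)).mulVecLin.image_convexHull _).symm
end
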